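/- arXiv:math/0402011 — 4 statements merged into one kernel-verified Lean document; each statement's English description precedes it below -/
import Mathlib

section
/- Let ϕ : [0,∞) → ℝ be measurable and suppose the radially symmetric function ω(x) = ϕ(|x|) is integrable and compactly supported on ℝ². Then for almost every x ≠ 0, (K ∗ ω)(x) = (x^⊥/|x|²) ∫₀^{|x|} s ϕ(s) ds. -/
open MeasureTheory Real Metric Filter
open scoped ENNReal Topology

/-- The plane `ℝ²` with the Euclidean norm. -/
noncomputable abbrev E2 : Type := EuclideanSpace ℝ (Fin 2)

/-- The 2D Biot–Savart kernel `K(x) = x^⊥ / (2π|x|²)`. -/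
noncomputable def K2 (x : E2) : E2 :=
  (2 * Real.pi * ‖x‖ ^ 2)⁻¹ • (WithLp.equiv 2 (Fin 2 → ℝ)).symm ![-(x 1), x 0]

/-- The velocity field `u = K ∗ ω` obtained from a vorticity `ω` by the Biot–Savart law. -/
noncomputable def vel (ω : E2 → ℝ) (x : E2) : E2 := ∫ y, ω y • K2 (x - y)

/-- The Cauchy kernel is locally integrable in the plane, hence its convolution with an integrable
function exists almost everywhere. -/
theorem ae_integrable_mul_inv_sub {f : ℂ → ℂ} (hf : Integrable f) :
    ∀ᵐ z : ℂ, Integrable fun w => f w * (z - w)⁻¹ := by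
  have hm : Measurable fun w : ℂ => w⁻¹ := measurable_inv
  have hnear : Integrable ((ball (0 : ℂ) 1).indicator fun w => w⁻¹) := by
    have h1 : Integrable fun w : ℂ => (Set.Iio (1 : ℝ)).indicator (fun r => r⁻¹) ‖w‖ := by
      rw [integrable_fun_norm_addHaar volume]
      have h2 : IntegrableOn ((Set.Ioo (0 : ℝ) 1).indicator fun _ => (1 : ℝ)) (Set.Ioi 0) := by
        refine Integrable.integrableOn ?_
        rw [integrable_indicator_iff measurableSet_Ioo]
        exact integrableOn_const (by simp) (by simp)
      refine h2.congr_fun (fun r (hr : 0 < r) => ?_) measurableSet_Ioi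
      by_cases h : r < 1 <;> simp [h, hr, hr.ne']
    refine h1.mono (hm.indicator measurableSet_ball).aestronglyMeasurable (ae_of_all _ fun w => ?_)
    by_cases h : ‖w‖ < 1 <;> simp [Set.indicator, h]
  filter_upwards [hf.ae_convolution_exists (ContinuousLinearMap.mul ℝ ℂ) hnear] with z hz
  have hfar : Integrable fun w => f w * ((ball (0 : ℂ) 1)ᶜ.indicator (fun w => w⁻¹) (z - w)) := by
    refine hf.mul_bdd (c := 1) ?_ (ae_of_all _ fun w => ?_)
    · exact ((hm.indicator measurableSet_ball.compl).comp
        (measurable_const.sub measurable_id)).aestronglyMeasurable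
    · by_cases h : ‖z - w‖ < 1
      · simp [Set.indicator, h]
      · simpa [Set.indicator, h] using inv_le_one_of_one_le₀ (not_lt.1 h)
  refine (hz.add hfar).congr (ae_of_all _ fun w => ?_)
  simp only [Pi.add_apply, ContinuousLinearMap.mul_apply', ← mul_add]
  rw [← Pi.add_apply, Set.indicator_self_add_compl]

theorem circleAverage_inv_sub_of_lt {z : ℂ} {r : ℝ} (hr : 0 < r) (h : r < ‖z‖) :
    circleAverage (fun w => (z - w)⁻¹) 0 r = z⁻¹ := by
  have hne : ∀ w ∈ closedBall (0 : ℂ) |r|, z - w ≠ 0 := by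
    intro w hw h0
    rw [mem_closedBall_zero_iff, abs_of_pos hr, ← sub_eq_zero.1 h0] at hw
    exact absurd h (not_lt.2 hw)
  rw [circleAverage_of_differentiable_on_off_countable Set.countable_empty, sub_zero]
  · exact (continuousOn_const.sub continuousOn_id).inv₀ hne
  · intro w hw
    exact ((differentiableAt_const z).sub differentiableAt_id).inv
      (hne w (ball_subset_closedBall hw.1))

theorem circleAverage_inv_sub_of_gt {z : ℂ} (hz : z ≠ 0) {r : ℝ} (h : ‖z‖ < r) :
    circleAverage (fun w => (z - w)⁻¹) 0 r = 0 := by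
  have hr : 0 < r := (norm_nonneg z).trans_lt h
  have hne : ∀ w ∈ sphere (0 : ℂ) |r|, z - w ≠ 0 := by
    intro w hw h0
    rw [mem_sphere_zero_iff_norm, abs_of_pos hr, ← sub_eq_zero.1 h0] at hw
    exact h.ne hw
  have hci : CircleIntegrable (fun w => (z - w)⁻¹) 0 r := by
    refine ContinuousOn.circleIntegrable' ?_
    exact (continuousOn_const.sub continuousOn_id).inv₀ hne
  have key : circleAverage (fun w => ((w - 0) / (w - z)) • (1 : ℂ)) 0 r = 1 :=
    circleAverage_sub_sub_inv_smul_of_differentiable_on_off_countable Set.countable_empty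
      continuousOn_const (fun _ _ => differentiableAt_const _)
      (by simpa [abs_of_pos hr] using h)
  have heq : circleAverage (fun w => ((w - 0) / (w - z)) • (1 : ℂ)) 0 r =
      circleAverage (fun w => 1 - z • (z - w)⁻¹) 0 r := by
    refine circleAverage_congr_sphere fun w hw => ?_
    have h1 := hne w hw
    have h2 : w - z ≠ 0 := by rwa [← neg_sub, neg_ne_zero]
    simp only [smul_eq_mul]
    field_simp
    ring
  have hconst : CircleIntegrable (fun _ : ℂ => (1 : ℂ)) 0 r := by simp
  have hsm : CircleIntegrable (fun w => z • (z - w)⁻¹) 0 r := hci.const_smul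
  rw [heq, circleAverage_fun_sub hconst hsm, circleAverage_const, circleAverage_fun_smul,
    sub_eq_self, smul_eq_mul] at key
  exact (mul_eq_zero.1 key).resolve_left hz

theorem integral_angle_eq_circleAverage (f : ℂ → ℂ) (r : ℝ) :
    ∫ θ in Set.Ioo (-π) π, f (r * (Real.cos θ + Real.sin θ * Complex.I)) =
      (2 * π : ℂ) * circleAverage f 0 r := by
  rw [circleAverage_eq_integral_add (-π), ← integral_Ioc_eq_integral_Ioo,
    ← intervalIntegral.integral_of_le (by linarith [pi_pos])]
  have h := intervalIntegral.integral_comp_add_right (a := 0) (b := 2 * π)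
    (fun θ => f (circleMap 0 r θ)) (-π)
  rw [h]
  have e : (0 : ℝ) + -π = -π ∧ 2 * π + -π = π := ⟨by ring, by ring⟩
  rw [e.1, e.2, Complex.real_smul]
  push_cast
  rw [mul_inv_cancel_left₀ (by simp [pi_ne_zero])]
  refine intervalIntegral.integral_congr fun θ _ => ?_
  simp [circleMap, Complex.exp_mul_I]

theorem integrableOn_polarCoord {f : ℂ → ℂ} (hm : Measurable f) (hf : Integrable f) :
    IntegrableOn (fun p : ℝ × ℝ => p.1 • f (Complex.polarCoord.symm p))
      Complex.polarCoord.target := by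
  have hs : Measurable fun p : ℝ × ℝ => Complex.polarCoord.symm p := by
    simp only [Complex.polarCoord_symm_apply]
    fun_prop
  refine ⟨(measurable_fst.smul (hm.comp hs)).aestronglyMeasurable, ?_⟩
  have h := hf.2
  rw [hasFiniteIntegral_iff_enorm, ← Complex.lintegral_comp_polarCoord_symm] at h
  rw [hasFiniteIntegral_iff_enorm]
  refine lt_of_eq_of_lt (setLIntegral_congr_fun
    Complex.polarCoord.open_target.measurableSet fun p hp => ?_) h
  have h0 : 0 < p.1 := (Set.mem_prod.1 hp).1
  simp only [enorm_smul, smul_eq_mul, Real.enorm_eq_ofReal h0.le]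

/-- The Cauchy transform of a radial function, at a point where it converges absolutely. -/
theorem integral_radial_mul_inv_sub {ϕ : ℝ → ℝ} (hmeas : Measurable ϕ) {z : ℂ} (hz : z ≠ 0)
    (hint : Integrable fun w : ℂ => (ϕ ‖w‖ : ℂ) * (z - w)⁻¹) :
    ∫ w : ℂ, (ϕ ‖w‖ : ℂ) * (z - w)⁻¹ =
      (2 * π : ℂ) * ((∫ s in (0 : ℝ)..‖z‖, s * ϕ s : ℝ) : ℂ) * z⁻¹ := by
  have hm : Measurable fun w : ℂ => (ϕ ‖w‖ : ℂ) * (z - w)⁻¹ := by fun_prop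
  have hpol := integrableOn_polarCoord hm hint
  rw [Complex.polarCoord_target] at hpol
  rw [← Complex.integral_comp_polarCoord_symm, polarCoord_target, Measure.volume_eq_prod,
    setIntegral_prod _ hpol]
  have hinner : ∀ r : ℝ, 0 < r → r ≠ ‖z‖ →
      ∫ θ in Set.Ioo (-π) π, r • ((ϕ ‖Complex.polarCoord.symm (r, θ)‖ : ℂ) *
        (z - Complex.polarCoord.symm (r, θ))⁻¹) =
      (Set.Ioc 0 ‖z‖).indicator (fun s => (2 * π : ℂ) * ((s * ϕ s : ℝ) : ℂ) * z⁻¹) r := by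
    intro r hr hne
    simp only [Complex.norm_polarCoord_symm, abs_of_pos hr]
    simp only [Complex.polarCoord_symm_apply, Complex.real_smul, ← mul_assoc]
    rw [integral_const_mul, integral_angle_eq_circleAverage (fun w => (z - w)⁻¹)]
    rcases lt_or_gt_of_ne hne with h | h
    · rw [circleAverage_inv_sub_of_lt hr h, Set.indicator_of_mem (Set.mem_Ioc.2 ⟨hr, h.le⟩)]
      push_cast
      ring
    · rw [circleAverage_inv_sub_of_gt hz h, Set.indicator_of_notMem (fun hmem => (Set.mem_Ioc.1 hmem).2.not_gt h)]
      simp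
  have hae : ∀ᵐ r : ℝ, r ∈ Set.Ioi (0 : ℝ) →
      ∫ θ in Set.Ioo (-π) π, r • ((ϕ ‖Complex.polarCoord.symm (r, θ)‖ : ℂ) *
        (z - Complex.polarCoord.symm (r, θ))⁻¹) =
      (Set.Ioc 0 ‖z‖).indicator (fun s => (2 * π : ℂ) * ((s * ϕ s : ℝ) : ℂ) * z⁻¹) r := by
    filter_upwards [Measure.ae_ne volume ‖z‖] with r hne hr using hinner r hr hne
  rw [setIntegral_congr_ae measurableSet_Ioi hae, setIntegral_indicator measurableSet_Ioc,
    Set.inter_eq_self_of_subset_right Set.Ioc_subset_Ioi_self, integral_mul_const,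
    integral_const_mul, intervalIntegral.integral_of_le (norm_nonneg z), integral_complex_ofReal]

theorem K2_orthonormalBasisOneI_repr (z : ℂ) :
    K2 (Complex.orthonormalBasisOneI.repr z) =
      Complex.orthonormalBasisOneI.repr
        ((Complex.I / (2 * π)) * starRingEnd ℂ z⁻¹) := by
  have h : (Complex.I / (2 * π)) * starRingEnd ℂ z⁻¹ =
      ((2 * π * ‖z‖ ^ 2)⁻¹ : ℝ) • (Complex.I * z) := by
    rw [Complex.inv_def, map_mul, Complex.conj_conj, Complex.conj_ofReal, Complex.normSq_eq_norm_sq,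
      Complex.real_smul]
    push_cast
    rw [mul_inv]
    ring
  rw [h, map_smul, K2, LinearIsometryEquiv.norm_map]
  congr 1
  ext i
  fin_cases i <;> simp [Complex.orthonormalBasisOneI_repr_apply]

/-- for an integrable, compactly supported, radially symmetric vorticity
`ω(x) = ϕ(|x|)`, the Biot–Savart law reduces, for a.e. `x ≠ 0`, to
`(K ∗ ω)(x) = (x^⊥/|x|²) ∫₀^{|x|} s ϕ(s) ds`. -/
theorem biot_savart_radial (ϕ : ℝ → ℝ) (hmeas : Measurable ϕ)
    (hint : Integrable (fun x : E2 => ϕ ‖x‖))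
    (hsupp : HasCompactSupport (fun x : E2 => ϕ ‖x‖)) :
    ∀ᵐ x ∂(volume : Measure E2), x ≠ 0 →
      vel (fun y => ϕ ‖y‖) x =
        ((∫ s in (0:ℝ)..‖x‖, s * ϕ s) / ‖x‖ ^ 2) •
          (WithLp.equiv 2 (Fin 2 → ℝ)).symm ![-(x 1), x 0] := by
  set L := Complex.orthonormalBasisOneI.repr with hL
  have hmp : MeasurePreserving L volume volume := L.measurePreserving
  have hme : MeasurableEmbedding L := L.toHomeomorph.measurableEmbedding
  have hintC : Integrable fun w : ℂ => (ϕ ‖w‖ : ℂ) := by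
    have h := (hmp.integrable_comp_emb hme).2 hint
    simpa [Function.comp_def] using h.ofReal (𝕜 := ℂ)
  have hsymm : MeasurePreserving L.symm volume volume := L.symm.measurePreserving
  filter_upwards [hsymm.quasiMeasurePreserving.ae (ae_integrable_mul_inv_sub hintC)]
    with x hx hx0
  obtain ⟨z, rfl⟩ := L.surjective x
  rw [L.symm_apply_apply] at hx
  have hz : z ≠ 0 := fun h => hx0 (by simp [h])
  have hvel : vel (fun y => ϕ ‖y‖) (L z) =
      L ((Complex.I / (2 * π)) * starRingEnd ℂ (∫ w : ℂ, (ϕ ‖w‖ : ℂ) * (z - w)⁻¹)) := by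
    rw [vel, ← hmp.integral_comp hme, ← integral_conj, ← integral_const_mul]
    refine Eq.trans ?_ (L.toLinearIsometry.integral_comp_comm _)
    refine integral_congr_ae (ae_of_all _ fun w => ?_)
    simp only [LinearIsometryEquiv.norm_map, ← map_sub, LinearIsometryEquiv.coe_toLinearIsometry]
    rw [hL, K2_orthonormalBasisOneI_repr, ← map_smul, Complex.real_smul,
      map_mul (starRingEnd ℂ), Complex.conj_ofReal]
    congr 1
    ring
  have hK : (WithLp.equiv 2 (Fin 2 → ℝ)).symm ![-(L z 1), L z 0] = L (Complex.I * z) := by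
    ext i
    fin_cases i <;> simp [hL, Complex.orthonormalBasisOneI_repr_apply]
  rw [hvel, integral_radial_mul_inv_sub hmeas hz hx, hK, ← map_smul, L.norm_map]
  congr 1
  simp only [map_mul, Complex.conj_ofReal, map_ofNat, Complex.inv_def, Complex.conj_conj,
    Complex.normSq_eq_norm_sq, Complex.real_smul]
  have hp : (π : ℂ) ≠ 0 := by simp [pi_ne_zero]
  push_cast
  field_simp
end

section
/- Fix 1/2 < α ≤ 2/3. For n ∈ ℕ, n ≥ 2, define ω^n_+ on ℝ² by ω^n_+(x) = n/(log n)^α if x ∈ B⁺(0;1/n) and ω^n_+(x) = ω^α_+(x) otherwise, and let u^n₁ denote the first component of K ∗ ω^n_+. Then lim_{n → ∞} ∫_{ℝ²} u^n₁(x) |ω^n_+(x)|² dx = +∞. -/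
open MeasureTheory Real Metric Filter
open scoped ENNReal Topology

/-- The vorticity `ω^α_+`, equal to `1/(|x| |log|x||^α)` on the upper half-disk
`B⁺(0;1/3)` and zero elsewhere. -/
noncomputable def omegaPlus (α : ℝ) (x : E2) : ℝ :=
  if ‖x‖ < 1/3 ∧ 0 < x 1 then 1 / (‖x‖ * |Real.log ‖x‖| ^ α) else 0

/-- The truncation `ω^n_+`: equal to `n/(log n)^α` on `B⁺(0;1/n)` and to `ω^α_+`
elsewhere. -/
noncomputable def omegaN (α : ℝ) (n : ℕ) (x : E2) : ℝ :=
  if ‖x‖ < 1/(n:ℝ) ∧ 0 < x 1 then (n:ℝ) / Real.log n ^ α else omegaPlus α x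

/-- The mean value property, with the circle run through at double speed. -/
lemma integral_comp_exp_two_mul {g : ℂ → ℂ} (hg : DiffContOnCl ℂ g (ball 0 1)) :
    ∫ θ in (0:ℝ)..π, g (Complex.exp (2 * θ * Complex.I)) = π * g 0 := by
  have h := DiffContOnCl.circleAverage (f := g) (c := 0) (R := 1) (by simpa using hg)
  rw [circleAverage_def] at h
  have h2 := intervalIntegral.integral_comp_mul_left (a := 0) (b := π)
    (fun θ : ℝ => g (circleMap 0 1 θ)) (c := 2) two_ne_zero
  have h3 : ∀ θ : ℝ, circleMap 0 1 (2 * θ) = Complex.exp (2 * θ * Complex.I) := by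
    intro θ; simp [circleMap]
  simp only [h3, mul_zero] at h2
  rw [h2, ← h]
  simp only [Complex.real_smul]
  push_cast
  field_simp

lemma integral_comp_exp_neg_two_mul {g : ℂ → ℂ} (hg : DiffContOnCl ℂ g (ball 0 1)) :
    ∫ θ in (0:ℝ)..π, g (Complex.exp (-(2 * θ * Complex.I))) = π * g 0 := by
  rw [← integral_comp_exp_two_mul hg]
  have := intervalIntegral.integral_comp_sub_left (a := 0) (b := π)
    (fun θ : ℝ => g (Complex.exp (2 * θ * Complex.I))) π
  simp only [sub_self, sub_zero] at this
  rw [← this]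
  congr 1; ext θ; congr 1
  push_cast
  rw [show 2 * ((π:ℂ) - θ) * Complex.I = 2 * π * Complex.I + -(2 * θ * Complex.I) by ring,
    Complex.exp_add, Complex.exp_two_pi_mul_I, one_mul]

lemma diffContOnCl_of_ne_zero {p q : ℂ → ℂ} (hp : Differentiable ℂ p) (hq : Differentiable ℂ q)
    (h : ∀ η, ‖η‖ ≤ 1 → q η ≠ 0) : DiffContOnCl ℂ (fun η => p η / q η) (ball 0 1) := by
  have : DifferentiableOn ℂ (fun η => p η / q η) (closure (ball 0 1)) := fun η hη => by
    rw [closure_ball _ one_ne_zero, mem_closedBall_zero_iff] at hη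
    exact ((hp η).div (hq η) (h η hη)).differentiableWithinAt
  exact this.diffContOnCl

lemma sq_sub_ne_zero {a b : ℝ} {z η : ℂ} (hb : 0 ≤ b) (hz : ‖z‖ = a) (hba : b < a)
    (hη : ‖η‖ ≤ 1) : z ^ 2 - b ^ 2 * η ≠ 0 := by
  intro h
  have h1 : ‖z ^ 2‖ = ‖(b : ℂ) ^ 2 * η‖ := by rw [sub_eq_zero.1 h]
  simp only [norm_pow, norm_mul, hz, Complex.norm_real, Real.norm_eq_abs, sq_abs] at h1
  nlinarith [norm_nonneg η]

lemma integral_inner_part {r s : ℝ} (hr : 0 ≤ r) (hrs : r < s) {z : ℂ} (hz : ‖z‖ = s) :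
    ∫ θ in (0:ℝ)..π, z / (z ^ 2 - (r * Complex.exp (θ * Complex.I)) ^ 2) = π / z := by
  have hz0 : z ≠ 0 := by rw [← norm_pos_iff, hz]; linarith
  have := integral_comp_exp_two_mul (g := fun η => z / (z ^ 2 - r ^ 2 * η))
    (diffContOnCl_of_ne_zero (by fun_prop) (by fun_prop)
      fun η hη => sq_sub_ne_zero hr hz hrs hη)
  simp only [mul_zero, sub_zero] at this
  rw [show (π:ℂ) / z = π * (z / z ^ 2) by field_simp, ← this]
  congr 1; ext θ
  rw [mul_pow, ← Complex.exp_nat_mul]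
  push_cast; ring_nf

lemma integral_outer_part {r s : ℝ} (hrs : r < s) {w : ℂ} (hw : ‖w‖ = r) :
    ∫ φ in (0:ℝ)..π, w / ((s * Complex.exp (φ * Complex.I)) ^ 2 - w ^ 2) = 0 := by
  have hs0 : 0 < s := lt_of_le_of_lt (hw ▸ norm_nonneg w) hrs
  have := integral_comp_exp_neg_two_mul (g := fun η => (w * η) / (s ^ 2 - w ^ 2 * η))
    (diffContOnCl_of_ne_zero (by fun_prop) (by fun_prop) fun η hη h => by
      have h1 : ‖(s : ℂ) ^ 2‖ = ‖w ^ 2 * η‖ := by rw [sub_eq_zero.1 h]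
      simp only [norm_pow, norm_mul, hw, Complex.norm_real, Real.norm_eq_abs, sq_abs] at h1
      nlinarith [norm_nonneg η, norm_nonneg w])
  simp only [mul_zero, zero_div] at this
  rw [← this]
  congr 1; ext φ
  rw [mul_pow, ← Complex.exp_nat_mul, Complex.exp_neg]
  have := Complex.exp_ne_zero (2 * φ * Complex.I)
  rw [show ((2:ℕ):ℂ) * (φ * Complex.I) = 2 * φ * Complex.I by push_cast; ring,
    ← mul_div_mul_right _ ((s:ℂ) ^ 2 - w ^ 2 * (Complex.exp (2 * φ * Complex.I))⁻¹) this]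
  field_simp

lemma sub_ne_zero_of_norm_lt {z w : ℂ} (h : ‖w‖ < ‖z‖) : z - w ≠ 0 := by
  rintro h0; rw [sub_eq_zero.1 h0] at h; exact h.false

lemma norm_mul_exp_I {r : ℝ} (hr : 0 ≤ r) (θ : ℝ) :
    ‖(r : ℂ) * Complex.exp (θ * Complex.I)‖ = r := by
  simp [Complex.norm_exp_ofReal_mul_I, abs_of_nonneg hr]

lemma integral_exp_neg_I :
    ∫ φ in (0:ℝ)..π, (Complex.exp (φ * Complex.I))⁻¹ = -2 * Complex.I := by
  have h := integral_exp_mul_complex (a := 0) (b := π) (c := -Complex.I) (by simp)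
  have h1 : ∀ φ : ℝ, (Complex.exp (φ * Complex.I))⁻¹ = Complex.exp (-Complex.I * φ) := by
    intro φ; rw [← Complex.exp_neg]; ring_nf
  simp only [h1]
  rw [h, show -Complex.I * (π:ℂ) = -(π * Complex.I) by ring, Complex.exp_neg, Complex.exp_pi_mul_I]
  simp only [Complex.ofReal_zero, mul_zero, Complex.exp_zero]
  rw [div_eq_iff (by simp)]
  ring_nf
  simp

/-- The measure `dθ` on the upper half of the circle. -/
noncomputable def halfAngle : Measure ℝ := volume.restrict (Set.Ioo 0 π)

instance : IsFiniteMeasure halfAngle := by unfold halfAngle; infer_instance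

lemma integral_halfAngle {E : Type*} [NormedAddCommGroup E] [NormedSpace ℝ E] (f : ℝ → E) :
    ∫ θ, f θ ∂halfAngle = ∫ θ in (0:ℝ)..π, f θ := by
  rw [intervalIntegral.integral_of_le pi_pos.le, integral_Ioc_eq_integral_Ioo, halfAngle]

lemma integrable_halfAngle_prod {f : ℝ × ℝ → ℂ} (hf : Continuous f) :
    Integrable f (halfAngle.prod halfAngle) := by
  rw [halfAngle, Measure.prod_restrict]
  exact (hf.continuousOn.integrableOn_compact (isCompact_Icc.prod isCompact_Icc)).mono_set
    (Set.prod_mono Set.Ioo_subset_Icc_self Set.Ioo_subset_Icc_self)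

lemma continuous_of_norm_lt {p q : ℝ × ℝ → ℂ} (hp : Continuous p) (hq : Continuous q)
    (h : ∀ x, ‖q x‖ < ‖p x‖) (f : ℂ → ℂ → ℂ) (hf : Continuous fun x => f (p x) (q x)) :
    Continuous fun x => f (p x) (q x) / (p x ^ 2 - q x ^ 2) :=
  hf.div (by fun_prop) fun x => by
    rw [sq_sub_sq]
    refine mul_ne_zero ?_ (sub_ne_zero_of_norm_lt (h x))
    rw [← sub_neg_eq_add]
    exact sub_ne_zero_of_norm_lt (by simpa using h x)

lemma integral_inv_sub_of_lt {r s : ℝ} (hr : 0 ≤ r) (hrs : r < s) :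
    ∫ p : ℝ × ℝ, (s * Complex.exp (p.2 * Complex.I) - r * Complex.exp (p.1 * Complex.I))⁻¹
      ∂halfAngle.prod halfAngle = -(2 * π / s) * Complex.I := by
  have hs : 0 ≤ s := hr.trans hrs.le
  set z : ℝ → ℂ := fun φ => s * Complex.exp (φ * Complex.I) with hz
  set w : ℝ → ℂ := fun θ => r * Complex.exp (θ * Complex.I) with hw
  have hwz : ∀ p : ℝ × ℝ, ‖w p.1‖ < ‖z p.2‖ := fun p => by
    simp only [hz, hw, norm_mul_exp_I hr, norm_mul_exp_I hs, hrs]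
  have cz : Continuous fun p : ℝ × ℝ => z p.2 := by fun_prop
  have cw : Continuous fun p : ℝ × ℝ => w p.1 := by fun_prop
  have hsplit : ∀ p : ℝ × ℝ, (z p.2 - w p.1)⁻¹ =
      z p.2 / (z p.2 ^ 2 - w p.1 ^ 2) + w p.1 / (z p.2 ^ 2 - w p.1 ^ 2) := by
    intro p
    have h1 := sub_ne_zero_of_norm_lt (hwz p)
    have h2 : z p.2 + w p.1 ≠ 0 := by
      rw [← sub_neg_eq_add]
      exact sub_ne_zero_of_norm_lt (by simpa using hwz p)
    rw [← add_div, sq_sub_sq]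
    field_simp
  have i1 := integrable_halfAngle_prod (continuous_of_norm_lt cz cw hwz (fun z _ => z) cz)
  have i2 := integrable_halfAngle_prod (continuous_of_norm_lt cz cw hwz (fun _ w => w) cw)
  change ∫ p : ℝ × ℝ, (z p.2 - w p.1)⁻¹ ∂_ = _
  simp only [hsplit]
  rw [integral_add i1 i2, integral_prod_symm _ i1, integral_prod _ i2]
  simp only [integral_halfAngle]
  have e1 : ∀ φ, ∫ θ in (0:ℝ)..π, z φ / (z φ ^ 2 - w θ ^ 2) =
      (π / s) * (Complex.exp (φ * Complex.I))⁻¹ := fun φ => by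
    rw [integral_inner_part hr hrs (norm_mul_exp_I hs φ), div_mul_eq_div_div,
      div_eq_mul_inv _ (Complex.exp _)]
  have e2 : ∀ θ, ∫ φ in (0:ℝ)..π, w θ / (z φ ^ 2 - w θ ^ 2) = 0 := fun θ =>
    integral_outer_part hrs (norm_mul_exp_I hr θ)
  simp only [e1, e2, intervalIntegral.integral_const_mul, integral_exp_neg_I]
  simp
  ring

/-- The angular average of the (first component of the) Biot–Savart interaction. -/
noncomputable def radialKernel (r s : ℝ) : ℝ := if r < s then s⁻¹ else -r⁻¹

lemma integral_im_inv_sub {r s : ℝ} (hr : 0 ≤ r) (hs : 0 ≤ s) (hrs : r ≠ s) :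
    ∫ p : ℝ × ℝ, ((r * Complex.exp (p.1 * Complex.I) - s * Complex.exp (p.2 * Complex.I))⁻¹).im
      ∂halfAngle.prod halfAngle = 2 * π * radialKernel r s := by
  have key : ∀ {r s : ℝ}, 0 ≤ r → r < s →
      ∫ p : ℝ × ℝ, ((s * Complex.exp (p.2 * Complex.I) - r * Complex.exp (p.1 * Complex.I))⁻¹).im
      ∂halfAngle.prod halfAngle = -(2 * π / s) := by
    intro r s hr hrs
    have hc : Continuous fun p : ℝ × ℝ =>
        (s * Complex.exp (p.2 * Complex.I) - r * Complex.exp (p.1 * Complex.I))⁻¹ := by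
      refine Continuous.inv₀ (by fun_prop) fun p => sub_ne_zero_of_norm_lt ?_
      rwa [norm_mul_exp_I hr, norm_mul_exp_I (hr.trans hrs.le)]
    have := integral_im (integrable_halfAngle_prod hc)
    simp only [RCLike.im_to_complex] at this
    rw [this, integral_inv_sub_of_lt hr hrs]
    rw [show -(2 * (π:ℂ) / s) = ((-(2 * π / s) : ℝ) : ℂ) by push_cast; ring, Complex.im_ofReal_mul]
    simp
  rcases hrs.lt_or_gt with h | h
  · have h1 := key hr h
    rw [radialKernel, if_pos h, ← div_eq_mul_inv, ← neg_eq_iff_eq_neg.2 h1, ← integral_neg]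
    congr 1; ext p
    rw [← Complex.neg_im, ← inv_neg, neg_sub]
  · have h1 := key hs h
    rw [radialKernel, if_neg h.not_gt, mul_neg, ← div_eq_mul_inv, ← h1, ← integral_prod_swap]
    rfl

/-- The measure `r dr` on the half-line. -/
noncomputable def radialMeasure : Measure ℝ :=
  (volume.restrict (Set.Ioi 0)).withDensity ENNReal.ofReal

instance : SFinite radialMeasure := by unfold radialMeasure; infer_instance

/-- Polar coordinates on the plane. -/
noncomputable def polarMap (p : ℝ × ℝ) : E2 :=
  Complex.orthonormalBasisOneI.repr (p.1 * Complex.exp (p.2 * Complex.I))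

lemma measurable_polarMap : Measurable polarMap := by
  unfold polarMap
  exact (LinearIsometryEquiv.continuous _).measurable.comp (by fun_prop)

lemma polarMap_eq (p : ℝ × ℝ) :
    polarMap p = Complex.orthonormalBasisOneI.repr (Complex.polarCoord.symm p) := by
  rw [polarMap, Complex.polarCoord_symm_apply, Complex.exp_mul_I, Complex.ofReal_cos,
    Complex.ofReal_sin]

lemma norm_polarMap (p : ℝ × ℝ) : ‖polarMap p‖ = |p.1| := by
  rw [polarMap_eq, LinearIsometryEquiv.norm_map, Complex.norm_polarCoord_symm]

lemma polarMap_apply_one (p : ℝ × ℝ) : polarMap p 1 = p.1 * sin p.2 := by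
  rw [polarMap_eq, Complex.polarCoord_symm_apply]
  change (Complex.im _) = _
  simp [Complex.sin_ofReal_re]

lemma measurableSet_upper : MeasurableSet {x : E2 | 0 < x 1} :=
  (isOpen_lt continuous_const (by fun_prop)).measurableSet

lemma polarMap_mem_upper {p : ℝ × ℝ} (h1 : 0 < p.1) (h2 : p.2 ∈ Set.Ioo (-π) π) :
    polarMap p ∈ {x : E2 | 0 < x 1} ↔ p.2 ∈ Set.Ioo 0 π := by
  rw [Set.mem_ofPred_eq, polarMap_apply_one, mul_pos_iff_of_pos_left h1]
  refine ⟨fun h => ⟨?_, h2.2⟩, fun h => sin_pos_of_mem_Ioo h⟩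
  by_contra! h3
  exact h.not_ge (sin_nonpos_of_nonpos_of_neg_pi_le h3 h2.1.le)

lemma measurePreserving_polarMap :
    MeasurePreserving polarMap (radialMeasure.prod halfAngle)
      (volume.restrict {x : E2 | 0 < x 1}) := by
  refine ⟨measurable_polarMap, Measure.ext fun A hA => ?_⟩
  have hB := hA.inter measurableSet_upper
  rw [Measure.map_apply measurable_polarMap hA, Measure.restrict_apply hA, radialMeasure,
    prod_withDensity_left ENNReal.measurable_ofReal, halfAngle, Measure.prod_restrict,
    withDensity_apply _ (measurable_polarMap hA), ← Measure.volume_eq_prod,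
    ← lintegral_indicator_one hB,
    ← (Complex.orthonormalBasisOneI.repr.measurePreserving).lintegral_comp
      (measurable_one.indicator hB),
    ← Complex.lintegral_comp_polarCoord_symm, Measure.restrict_restrict (measurable_polarMap hA),
    ← lintegral_indicator ((measurable_polarMap hA).inter
      (measurableSet_Ioi.prod measurableSet_Ioo)),
    ← lintegral_indicator polarCoord.open_target.measurableSet]
  congr 1; ext p
  simp only [← polarMap_eq]
  by_cases hp : p ∈ polarCoord.target
  · have h := polarMap_mem_upper hp.1 hp.2
    rw [Set.indicator_of_mem hp]
    by_cases hpA : polarMap p ∈ A ∩ {x : E2 | 0 < x 1}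
    · rw [Set.indicator_of_mem hpA, Set.indicator_of_mem]
      · simp
      · exact ⟨hpA.1, hp.1, h.1 hpA.2⟩
    · rw [Set.indicator_of_notMem hpA, Set.indicator_of_notMem]
      · simp
      · rintro ⟨h1, h2, h3⟩
        exact hpA ⟨h1, h.2 h3⟩
  · rw [Set.indicator_of_notMem hp, Set.indicator_of_notMem]
    rintro ⟨h1, h2, h3⟩
    exact hp ⟨h2, by linarith [h3.1, pi_pos], h3.2⟩

lemma measurePreserving_prodProdProdComm {α β γ δ : Type*} [MeasurableSpace α]
    [MeasurableSpace β] [MeasurableSpace γ] [MeasurableSpace δ] (μ : Measure α) (ν : Measure β)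
    (ρ : Measure γ) (τ : Measure δ) [SFinite μ] [SFinite ν] [SFinite ρ] [SFinite τ] :
    MeasurePreserving (Equiv.prodProdProdComm α β γ δ) ((μ.prod ν).prod (ρ.prod τ))
      ((μ.prod ρ).prod (ν.prod τ)) := by
  have h1 := measurePreserving_prodAssoc μ ν (ρ.prod τ)
  have h2 := (MeasurePreserving.id μ).prod
    ((measurePreserving_prodAssoc ν ρ τ).symm MeasurableEquiv.prodAssoc)
  have h3 := (MeasurePreserving.id μ).prod
    ((Measure.measurePreserving_swap (μ := ν) (ν := ρ)).prod (MeasurePreserving.id τ))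
  have h4 := (MeasurePreserving.id μ).prod (measurePreserving_prodAssoc ρ ν τ)
  have h5 := (measurePreserving_prodAssoc μ ρ (ν.prod τ)).symm MeasurableEquiv.prodAssoc
  exact h5.comp (h4.comp (h3.comp (h2.comp h1)))

lemma measurable_K2 : Measurable K2 := by
  unfold K2
  have h : Measurable fun x : E2 => (2 * π * ‖x‖ ^ 2)⁻¹ := by fun_prop
  refine h.smul ?_
  refine (PiLp.continuous_toLp 2 _).measurable.comp (measurable_pi_lambda _ fun i => ?_)
  fin_cases i <;> simp <;> fun_prop

lemma K2_apply_zero (x : E2) : K2 x 0 = -(2 * π * ‖x‖ ^ 2)⁻¹ * x 1 := by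
  simp [K2]

lemma norm_K2 (x : E2) : ‖K2 x‖ = (2 * π)⁻¹ * ‖x‖⁻¹ := by
  have : ‖(WithLp.equiv 2 (Fin 2 → ℝ)).symm ![-(x 1), x 0]‖ = ‖x‖ := by
    simp [EuclideanSpace.norm_eq, Fin.sum_univ_two, add_comm]
  rw [K2, norm_smul, this, norm_inv, norm_mul, norm_mul, norm_pow, norm_norm, norm_two,
    Real.norm_of_nonneg pi_pos.le]
  rcases eq_or_ne ‖x‖ 0 with h | h
  · simp [h]
  · field_simp

lemma K2_repr_apply_zero (z : ℂ) :
    K2 (Complex.orthonormalBasisOneI.repr z) 0 = (2 * π)⁻¹ * (z⁻¹).im := by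
  have h1 : (Complex.orthonormalBasisOneI.repr z) 1 = z.im := rfl
  rw [K2_apply_zero, LinearIsometryEquiv.norm_map, Complex.inv_im, Complex.normSq_eq_norm_sq, h1,
    mul_inv]
  ring

lemma integrable_indicator_K2 : Integrable ((ball (0 : E2) 1).indicator K2) := by
  rw [integrable_indicator_iff measurableSet_ball]
  have h : IntegrableOn (fun x : E2 => (2 * π)⁻¹ * ‖x‖⁻¹) (ball 0 1) := by
    rw [integrableOn_fun_norm_addHaar (volume : Measure E2) (f := fun r : ℝ => (2 * π)⁻¹ * r⁻¹)]
    have : IntegrableOn (fun _ : ℝ => (2 * π)⁻¹) (Set.Ioo 0 1) := by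
      exact integrableOn_const measure_Ioo_lt_top.ne
    refine this.congr_fun (fun r hr => ?_) measurableSet_Ioo
    have := hr.1.ne'
    simp [finrank_euclideanSpace]
    field_simp
  exact h.mono' measurable_K2.aestronglyMeasurable (.of_forall fun x => (norm_K2 x).le)

/-- The restriction to the upper half-plane of the radial function with profile `f`. -/
noncomputable def halfRadial (f : ℝ → ℝ) (x : E2) : ℝ := if 0 < x 1 then f ‖x‖ else 0

section HalfRadial

variable {f : ℝ → ℝ} {M : ℝ}

lemma measurable_halfRadial (hf : Measurable f) : Measurable (halfRadial f) :=
  Measurable.ite measurableSet_upper (hf.comp measurable_norm) measurable_const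

lemma norm_halfRadial_le (hM : ∀ r, ‖f r‖ ≤ M) (x : E2) : ‖halfRadial f x‖ ≤ M := by
  unfold halfRadial
  split_ifs
  · exact hM _
  · simpa using (norm_nonneg _).trans (hM 0)

lemma halfRadial_eq_zero (hs : ∀ r, 1/2 ≤ r → f r = 0) {x : E2} (hx : 1/2 ≤ ‖x‖) :
    halfRadial f x = 0 := by
  unfold halfRadial
  split_ifs
  · exact hs _ hx
  · rfl

lemma integrable_halfRadial (hf : Measurable f) (hM : ∀ r, ‖f r‖ ≤ M)
    (hs : ∀ r, 1/2 ≤ r → f r = 0) : Integrable (halfRadial f) := by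
  have : IntegrableOn (halfRadial f) (ball 0 (1/2)) :=
    Measure.integrableOn_of_bounded (M := M) measure_ball_lt_top.ne
      (measurable_halfRadial hf).aestronglyMeasurable
      (.of_forall (norm_halfRadial_le hM))
  refine (integrableOn_iff_integrable_of_support_subset fun x hx => ?_).1 this
  by_contra h
  exact hx (halfRadial_eq_zero hs (by simpa using h))

/-- Inside the support of `halfRadial f` the kernel may be truncated. -/
lemma halfRadial_smul_indicator (hs : ∀ r, 1/2 ≤ r → f r = 0) {x y : E2}
    (hx : halfRadial f x ≠ 0) :
    halfRadial f y • (ball (0 : E2) 1).indicator K2 (x - y) = halfRadial f y • K2 (x - y) := by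
  by_cases hy : halfRadial f y = 0
  · simp [hy]
  · have h1 : ‖x‖ < 1/2 := by contrapose! hx; exact halfRadial_eq_zero hs hx
    have h2 : ‖y‖ < 1/2 := by contrapose! hy; exact halfRadial_eq_zero hs hy
    rw [Set.indicator_of_mem]
    rw [mem_ball_zero_iff]
    linarith [norm_sub_le x y]

lemma integrable_halfRadial_smul (hf : Measurable f) (hM : ∀ r, ‖f r‖ ≤ M)
    (hs : ∀ r, 1/2 ≤ r → f r = 0) :
    Integrable (fun p : E2 × E2 =>
      halfRadial f p.2 • (ball (0 : E2) 1).indicator K2 (p.1 - p.2)) :=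
  (integrable_halfRadial hf hM hs).convolution_integrand (ContinuousLinearMap.lsmul ℝ ℝ)
    integrable_indicator_K2

lemma integrable_cubic (hf : Measurable f) (hM : ∀ r, ‖f r‖ ≤ M)
    (hs : ∀ r, 1/2 ≤ r → f r = 0) :
    Integrable (fun p : E2 × E2 =>
      halfRadial f p.1 ^ 2 * (halfRadial f p.2 * K2 (p.1 - p.2) 0)) := by
  have h1 := (EuclideanSpace.proj (𝕜 := ℝ) (0 : Fin 2)).integrable_comp
    (integrable_halfRadial_smul hf hM hs)
  have h2 := h1.bdd_mul (f := fun p : E2 × E2 => halfRadial f p.1 ^ 2) (c := M ^ 2)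
    (((measurable_halfRadial hf).comp measurable_fst).pow_const 2).aestronglyMeasurable
    (.of_forall fun p => by
      rw [norm_pow]
      exact pow_le_pow_left₀ (norm_nonneg _) (norm_halfRadial_le hM _) 2)
  refine h2.congr (.of_forall fun p => ?_)
  by_cases hx : halfRadial f p.1 = 0
  · simp [hx]
  · simp only [halfRadial_smul_indicator hs hx]
    simp

lemma integral_vel_mul_sq (hf : Measurable f) (hM : ∀ r, ‖f r‖ ≤ M)
    (hs : ∀ r, 1/2 ≤ r → f r = 0) :
    ∫ x, vel (halfRadial f) x 0 * halfRadial f x ^ 2 =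
      ∫ p : E2 × E2, halfRadial f p.1 ^ 2 * (halfRadial f p.2 * K2 (p.1 - p.2) 0) := by
  rw [Measure.volume_eq_prod, integral_prod _ (integrable_cubic hf hM hs)]
  refine integral_congr_ae ?_
  filter_upwards [(integrable_halfRadial_smul hf hM hs).prod_right_ae] with x hx
  by_cases h : halfRadial f x = 0
  · simp [h]
  · simp only [halfRadial_smul_indicator hs h] at hx
    have := (EuclideanSpace.proj (𝕜 := ℝ) (0 : Fin 2)).integral_comp_comm hx
    rw [integral_const_mul, mul_comm]
    congr 1
    exact this.symm

/-- The integrand of the cubic integral, in polar coordinates. -/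
noncomputable def polarIntegrand (f : ℝ → ℝ) (q : (ℝ × ℝ) × (ℝ × ℝ)) : ℝ :=
  f |q.1.1| ^ 2 * (f |q.1.2| * ((2 * π)⁻¹ *
    ((q.1.1 * Complex.exp (q.2.1 * Complex.I) - q.1.2 * Complex.exp (q.2.2 * Complex.I))⁻¹).im))

lemma cubic_eq_indicator (x y : E2) :
    halfRadial f x ^ 2 * (halfRadial f y * K2 (x - y) 0) =
      ({x : E2 | 0 < x 1} ×ˢ {x : E2 | 0 < x 1}).indicator
        (fun p : E2 × E2 => f ‖p.1‖ ^ 2 * (f ‖p.2‖ * K2 (p.1 - p.2) 0)) (x, y) := by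
  by_cases hx : 0 < x 1 <;> by_cases hy : 0 < y 1 <;> simp [halfRadial, hx, hy]

lemma polarIntegrand_eq (p : (ℝ × ℝ) × (ℝ × ℝ)) :
    f ‖polarMap p.1‖ ^ 2 * (f ‖polarMap p.2‖ * K2 (polarMap p.1 - polarMap p.2) 0) =
      polarIntegrand f (Equiv.prodProdProdComm ℝ ℝ ℝ ℝ p) := by
  rw [norm_polarMap, norm_polarMap, polarMap, polarMap, ← map_sub, K2_repr_apply_zero]
  rfl

lemma polar_change (hf : Measurable f) (hM : ∀ r, ‖f r‖ ≤ M)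
    (hs : ∀ r, 1/2 ≤ r → f r = 0) :
    Integrable (polarIntegrand f)
      ((radialMeasure.prod radialMeasure).prod (halfAngle.prod halfAngle)) ∧
    ∫ q, polarIntegrand f q
      ∂(radialMeasure.prod radialMeasure).prod (halfAngle.prod halfAngle) =
      ∫ p : E2 × E2, halfRadial f p.1 ^ 2 * (halfRadial f p.2 * K2 (p.1 - p.2) 0) := by
  have hU := measurableSet_upper.prod measurableSet_upper
  have hint := integrable_cubic hf hM hs
  simp only [cubic_eq_indicator, Prod.mk.eta] at hint ⊢
  rw [integrable_indicator_iff hU, IntegrableOn, Measure.volume_eq_prod,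
    ← Measure.prod_restrict] at hint
  rw [integral_indicator hU, Measure.volume_eq_prod, ← Measure.prod_restrict]
  have hP := measurePreserving_polarMap.prod measurePreserving_polarMap
  have hC := measurePreserving_prodProdProdComm radialMeasure halfAngle radialMeasure halfAngle
  have hCe : MeasurableEmbedding (Equiv.prodProdProdComm ℝ ℝ ℝ ℝ) :=
    Measurable.measurableEmbedding hC.measurable (Equiv.injective _)
  have hi := hP.integrable_comp_of_integrable hint
  have heq : (fun p : E2 × E2 => f ‖p.1‖ ^ 2 * (f ‖p.2‖ * K2 (p.1 - p.2) 0)) ∘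
      Prod.map polarMap polarMap = polarIntegrand f ∘ Equiv.prodProdProdComm ℝ ℝ ℝ ℝ :=
    funext fun p => polarIntegrand_eq p
  constructor
  · rw [← hC.integrable_comp_emb hCe, ← heq]
    exact hi
  · rw [← hC.integral_comp hCe, ← hP.map_eq, integral_map hP.aemeasurable]
    · exact integral_congr_ae (.of_forall fun p => (congrFun heq p).symm)
    · rw [hP.map_eq]; exact hint.aestronglyMeasurable

lemma ae_radialMeasure : ∀ᵐ r ∂radialMeasure, 0 < r :=
  (withDensity_absolutelyContinuous _ _).ae_le (ae_restrict_mem measurableSet_Ioi)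

lemma ae_radialMeasure_prod : ∀ᵐ p : ℝ × ℝ ∂radialMeasure.prod radialMeasure,
    0 < p.1 ∧ 0 < p.2 ∧ p.1 ≠ p.2 := by
  have hm : MeasurableSet {p : ℝ × ℝ | 0 < p.1 ∧ 0 < p.2 ∧ p.1 ≠ p.2} :=
    (measurableSet_lt measurable_const measurable_fst).inter
      ((measurableSet_lt measurable_const measurable_snd).inter
        (measurableSet_eq_fun measurable_fst measurable_snd).compl)
  rw [Measure.ae_prod_iff_ae_ae hm]
  filter_upwards [ae_radialMeasure] with r hr
  have : ∀ᵐ s ∂radialMeasure, s ≠ r := (withDensity_absolutelyContinuous _ _).ae_le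
    (ae_restrict_of_ae (Measure.ae_ne volume r))
  filter_upwards [ae_radialMeasure, this] with s h1 h2
  exact ⟨hr, h1, h2.symm⟩

/-- The cubic integral of a half-radial function, reduced to a double integral over radii. -/
lemma integral_vel_mul_sq_eq_radial (hf : Measurable f) (hM : ∀ r, ‖f r‖ ≤ M)
    (hs : ∀ r, 1/2 ≤ r → f r = 0) :
    Integrable (fun p : ℝ × ℝ => f p.1 ^ 2 * (f p.2 * radialKernel p.1 p.2))
      (radialMeasure.prod radialMeasure) ∧
    ∫ x, vel (halfRadial f) x 0 * halfRadial f x ^ 2 =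
      ∫ p : ℝ × ℝ, f p.1 ^ 2 * (f p.2 * radialKernel p.1 p.2)
        ∂radialMeasure.prod radialMeasure := by
  obtain ⟨h1, h2⟩ := polar_change hf hM hs
  have h3 : (fun p => ∫ a, polarIntegrand f (p, a) ∂halfAngle.prod halfAngle) =ᵐ[
      radialMeasure.prod radialMeasure]
      fun p : ℝ × ℝ => f p.1 ^ 2 * (f p.2 * radialKernel p.1 p.2) := by
    filter_upwards [ae_radialMeasure_prod] with p hp
    obtain ⟨hp1, hp2, hp3⟩ := hp
    simp only [polarIntegrand, integral_const_mul, integral_im_inv_sub hp1.le hp2.le hp3,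
      abs_of_pos hp1, abs_of_pos hp2]
    field_simp
  refine ⟨h1.integral_prod_left.congr h3, ?_⟩
  rw [integral_vel_mul_sq hf hM hs, ← h2, integral_prod _ h1, integral_congr_ae h3]

end HalfRadial

lemma integral_radialMeasure (g : ℝ → ℝ) :
    ∫ r, g r ∂radialMeasure = ∫ r in Set.Ioi 0, r * g r := by
  rw [radialMeasure, integral_withDensity_eq_integral_toReal_smul ENNReal.measurable_ofReal
    (.of_forall fun _ => ENNReal.ofReal_lt_top)]
  refine setIntegral_congr_fun measurableSet_Ioi fun r hr => ?_
  simp only [ENNReal.toReal_ofReal (Set.mem_Ioi.1 hr).le, smul_eq_mul]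

lemma integrableOn_of_integrable_radialMeasure {g : ℝ → ℝ} (hg : Integrable g radialMeasure) :
    IntegrableOn (fun r => r * g r) (Set.Ioi 0) := by
  rw [radialMeasure, integrable_withDensity_iff_integrable_smul' ENNReal.measurable_ofReal
    (.of_forall fun _ => ENNReal.ofReal_lt_top)] at hg
  refine IntegrableOn.congr_fun hg (fun r hr => ?_) measurableSet_Ioi
  simp only [ENNReal.toReal_ofReal (Set.mem_Ioi.1 hr).le, smul_eq_mul]

lemma measurable_radialKernel (r : ℝ) : Measurable (radialKernel r) :=
  Measurable.ite measurableSet_Ioi measurable_inv measurable_const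

/-- The average velocity on the half-circle of radius `r`. -/
noncomputable def meanVelocity (f : ℝ → ℝ) (r : ℝ) : ℝ :=
  ∫ s, f s * radialKernel r s ∂radialMeasure

section Profile

variable {f : ℝ → ℝ} {M : ℝ}

lemma integrableOn_profile (hf : Measurable f) (hM : ∀ r, ‖f r‖ ≤ M)
    (hs : ∀ r, 1/2 ≤ r → f r = 0) : IntegrableOn f (Set.Ioi 0) := by
  have : IntegrableOn f (Set.Ioo 0 (1/2)) :=
    Measure.integrableOn_of_bounded (M := M) measure_Ioo_lt_top.ne
      hf.aestronglyMeasurable (.of_forall hM)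
  refine this.of_forall_sdiff_eq_zero measurableSet_Ioi fun r hr => hs r ?_
  by_contra! h
  exact hr.2 ⟨hr.1, h⟩

lemma le_meanVelocity (hf : Measurable f) (hM : ∀ r, ‖f r‖ ≤ M)
    (hs : ∀ r, 1/2 ≤ r → f r = 0) (h0 : ∀ r, 0 ≤ f r) (h1 : ∀ r, 0 < r → r * f r ≤ 1)
    {r b : ℝ} (hr : 0 < r) :
    (∫ s in Set.Ioo r b, f s) - 1 ≤ meanVelocity f r := by
  have hfi := integrableOn_profile hf hM hs
  have hsub : Set.Ioo r b ⊆ Set.Ioi 0 := fun s h => hr.trans h.1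
  have hci : IntegrableOn ((Set.Ioc 0 r).indicator fun _ => r⁻¹) (Set.Ioi 0) :=
    (IntegrableOn.integrable_indicator (integrableOn_const measure_Ioc_lt_top.ne)
      measurableSet_Ioc).integrableOn
  have e : (∫ s in Set.Ioo r b, f s) - 1 = ∫ s in Set.Ioi 0,
      ((Set.Ioo r b).indicator f s - (Set.Ioc 0 r).indicator (fun _ => r⁻¹) s) := by
    rw [integral_sub (hfi.indicator measurableSet_Ioo), setIntegral_indicator measurableSet_Ioo,
      setIntegral_indicator measurableSet_Ioc, Set.inter_eq_right.2 hsub,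
      Set.inter_eq_right.2 Set.Ioc_subset_Ioi_self]
    · simp [hr.le, hr.ne']
    · exact hci
  rw [e, meanVelocity, integral_radialMeasure]
  refine setIntegral_mono_on ?_ ?_ measurableSet_Ioi fun s hs0 => ?_
  · exact (hfi.indicator measurableSet_Ioo).sub hci
  · refine Integrable.mono' hfi (measurable_id.mul
      (hf.mul (measurable_radialKernel r))).aestronglyMeasurable ?_
    filter_upwards [ae_restrict_mem measurableSet_Ioi] with s (hs0 : 0 < s)
    simp only [radialKernel, norm_mul, Real.norm_eq_abs, abs_of_pos hs0, abs_of_nonneg (h0 s)]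
    split_ifs with h
    · rw [abs_of_pos (inv_pos.2 hs0)]
      field_simp
      rfl
    · rw [abs_neg, abs_of_pos (inv_pos.2 hr)]
      rw [mul_comm s, mul_assoc, mul_comm r⁻¹]
      refine mul_le_of_le_one_right (h0 s) ?_
      rw [← div_eq_mul_inv, div_le_one hr]
      exact not_lt.1 h
  · have hs0 : 0 < s := hs0
    simp only [radialKernel]
    split_ifs with h
    · rw [Set.indicator_of_notMem (s := Set.Ioc 0 r) (by simp [h]), sub_zero]
      rw [show s * (f s * s⁻¹) = f s by field_simp]
      exact Set.indicator_le_self' (fun _ _ => h0 _) s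
    · rw [Set.indicator_of_notMem (s := Set.Ioo r b) (fun h' => h h'.1),
        Set.indicator_of_mem (s := Set.Ioc 0 r) ⟨hs0, not_lt.1 h⟩]
      have := mul_le_mul_of_nonneg_right (h1 s hs0) (inv_pos.2 hr).le
      nlinarith

lemma integral_vel_mul_sq_eq_meanVelocity (hf : Measurable f) (hM : ∀ r, ‖f r‖ ≤ M)
    (hs : ∀ r, 1/2 ≤ r → f r = 0) :
    IntegrableOn (fun r => r * (f r ^ 2 * meanVelocity f r)) (Set.Ioi 0) ∧
    ∫ x, vel (halfRadial f) x 0 * halfRadial f x ^ 2 =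
      ∫ r in Set.Ioi 0, r * (f r ^ 2 * meanVelocity f r) := by
  obtain ⟨h1, h2⟩ := integral_vel_mul_sq_eq_radial hf hM hs
  have h3 := h1.integral_prod_left
  simp only [integral_const_mul] at h3
  refine ⟨integrableOn_of_integrable_radialMeasure h3, ?_⟩
  rw [h2, integral_prod _ h1, integral_radialMeasure]
  simp only [integral_const_mul, meanVelocity]

end Profile

/-- The radial profile of `omegaN`. -/
noncomputable def profileN (α : ℝ) (n : ℕ) (r : ℝ) : ℝ :=
  if r < 1/(n:ℝ) then (n:ℝ) / Real.log n ^ α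
  else if r < 1/3 then 1 / (r * |Real.log r| ^ α) else 0

lemma omegaN_eq_halfRadial (α : ℝ) (n : ℕ) : omegaN α n = halfRadial (profileN α n) := by
  ext x
  simp only [omegaN, omegaPlus, halfRadial, profileN]
  split_ifs <;> first | rfl | tauto

lemma measurable_profileN (α : ℝ) (n : ℕ) : Measurable (profileN α n) :=
  Measurable.ite measurableSet_Iio measurable_const
    (Measurable.ite measurableSet_Iio (by fun_prop) measurable_const)

lemma one_le_log_of_three_le {x : ℝ} (hx : 3 ≤ x) : 1 ≤ Real.log x := by
  rw [Real.le_log_iff_exp_le (by linarith)]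
  linarith [Real.exp_one_lt_d9]

lemma one_le_neg_log {r : ℝ} (hr : 0 < r) (hr3 : r ≤ 1/3) : 1 ≤ -Real.log r := by
  rw [← Real.log_inv]
  refine one_le_log_of_three_le ?_
  rw [le_inv_comm₀ (by norm_num) hr]
  simpa using hr3

section ProfileN

variable {α : ℝ} {n : ℕ}

lemma profileN_of_mem {r : ℝ} (hn : 0 < n) (hr : r ∈ Set.Ico (1/(n:ℝ)) (1/3)) :
    profileN α n r = 1 / (r * (-Real.log r) ^ α) := by
  have hr0 : 0 < r := lt_of_lt_of_le (by positivity) hr.1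
  rw [profileN, if_neg hr.1.not_gt, if_pos hr.2, abs_of_nonpos]
  linarith [one_le_neg_log hr0 hr.2.le]

lemma profileN_nonneg (r : ℝ) : 0 ≤ profileN α n r := by
  unfold profileN
  split_ifs with h1 h2
  · exact div_nonneg (by positivity) (Real.rpow_nonneg (Real.log_natCast_nonneg n) _)
  · have : 0 ≤ r := le_trans (by positivity) (not_lt.1 h1)
    positivity
  · rfl

lemma div_log_rpow_le (hα : 0 ≤ α) (hn : 3 ≤ n) : (n:ℝ) / Real.log n ^ α ≤ n :=
  div_le_self (by positivity)
    (Real.one_le_rpow (one_le_log_of_three_le (by exact_mod_cast hn)) hα)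

lemma mul_profileN_le (hα : 0 ≤ α) (hn : 3 ≤ n) {r : ℝ} (hr : 0 < r) :
    r * profileN α n r ≤ 1 := by
  have hn0 : (0:ℝ) < n := by positivity
  by_cases h1 : r < 1/(n:ℝ)
  · rw [profileN, if_pos h1]
    calc r * (n / Real.log n ^ α) ≤ 1/n * n := by gcongr; exact div_log_rpow_le hα hn
      _ = 1 := by field_simp
  · by_cases h2 : r < 1/3
    · rw [profileN_of_mem (by omega) ⟨not_lt.1 h1, h2⟩]
      have := Real.one_le_rpow (one_le_neg_log hr h2.le) hα
      have h0 : 0 < (-Real.log r) ^ α := by linarith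
      rw [show r * (1 / (r * (-Real.log r) ^ α)) = 1 / (-Real.log r) ^ α by field_simp,
        div_le_one h0]
      exact this
    · rw [profileN, if_neg h1, if_neg h2]; simp

lemma profileN_le (hα : 0 ≤ α) (hn : 3 ≤ n) (r : ℝ) : profileN α n r ≤ n := by
  by_cases h1 : r < 1/(n:ℝ)
  · rw [profileN, if_pos h1]
    exact div_log_rpow_le hα hn
  · have hn0 : (0:ℝ) < n := by positivity
    have hr : 1/(n:ℝ) ≤ r := not_lt.1 h1
    have h2 := (mul_le_mul_of_nonneg_right hr (profileN_nonneg (α := α) (n := n) r)).trans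
      (mul_profileN_le hα hn (lt_of_lt_of_le (by positivity) hr))
    rwa [one_div, inv_mul_le_one₀ hn0] at h2

lemma norm_profileN_le (hα : 0 ≤ α) (hn : 3 ≤ n) (r : ℝ) : ‖profileN α n r‖ ≤ n := by
  rw [Real.norm_of_nonneg (profileN_nonneg r)]
  exact profileN_le hα hn r

lemma profileN_eq_zero (hn : 3 ≤ n) (r : ℝ) (hr : 1/2 ≤ r) : profileN α n r = 0 := by
  have h : 1/(n:ℝ) ≤ 1/3 := one_div_le_one_div_of_le (by norm_num) (by exact_mod_cast hn)
  rw [profileN, if_neg (by linarith), if_neg (by linarith)]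

lemma integral_profileN (hα : α < 1) (hn : 3 ≤ n) {r : ℝ} (hr : r ∈ Set.Ico (1/(n:ℝ)) (1/3)) :
    ∫ s in Set.Ioo r (1/3), profileN α n s =
      ((-Real.log r) ^ (1 - α) - (-Real.log (1/3)) ^ (1 - α)) / (1 - α) := by
  have hr0 : 0 < r := lt_of_lt_of_le (by positivity) hr.1
  have hL : ∀ s ∈ Set.uIcc r (1/3), 0 < s ∧ 1 ≤ -Real.log s := fun s hs => by
    rw [Set.uIcc_of_le hr.2.le] at hs
    exact ⟨hr0.trans_le hs.1, one_le_neg_log (hr0.trans_le hs.1) hs.2⟩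
  rw [setIntegral_congr_fun (g := fun s => 1 / (s * (-Real.log s) ^ α)) measurableSet_Ioo
    fun s hs => profileN_of_mem (by omega) ⟨hr.1.trans hs.1.le, hs.2⟩,
    ← integral_Ioc_eq_integral_Ioo, ← intervalIntegral.integral_of_le hr.2.le]
  have h1 : 1 - α ≠ 0 := by linarith
  rw [intervalIntegral.integral_eq_sub_of_hasDerivAt
    (f := fun s => -((-Real.log s) ^ (1 - α) / (1 - α)))]
  · ring
  · intro s hs
    obtain ⟨hs0, hs1⟩ := hL s hs
    have hd := (((Real.hasDerivAt_log hs0.ne').neg.rpow_const (p := 1 - α)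
      (Or.inl (by simp only [Pi.neg_apply]; linarith))).div_const (1 - α)).neg
    refine hd.congr_deriv ?_
    simp only [Pi.neg_apply]
    rw [show 1 - α - 1 = -α by ring, Real.rpow_neg (by linarith)]
    have : (-Real.log s) ^ α ≠ 0 := (Real.rpow_pos_of_pos (by linarith) _).ne'
    field_simp
  · refine ContinuousOn.intervalIntegrable fun s hs => ContinuousAt.continuousWithinAt ?_
    obtain ⟨hs0, hs1⟩ := hL s hs
    have : (-Real.log s) ^ α ≠ 0 := (Real.rpow_pos_of_pos (by linarith) _).ne'
    refine continuousAt_const.div (continuousAt_id.mul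
      ((Real.continuousAt_log hs0.ne').neg.rpow_const
        (Or.inl (by simp only [Pi.neg_apply]; linarith)))) ?_
    exact mul_ne_zero hs0.ne' this

end ProfileN

lemma log_weight_lower_bound {α K L : ℝ} (hα1 : 1/2 < α) (hα2 : α ≤ 2/3) (hK : 0 ≤ K)
    (hL : 1 ≤ L) :
    1 / L - K ^ 3 / L ^ 2 ≤ (1 / L ^ α) ^ 2 * (L ^ (1 - α) / (1 - α) - K) := by
  have hL0 : 0 < L := by linarith
  set t := L ^ (1 - α) with ht
  have hu : 1 / L ^ α = t / L := by
    rw [ht, Real.rpow_sub hL0, Real.rpow_one]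
    field_simp
  have ht1 : 1 ≤ t := Real.one_le_rpow hL (by linarith)
  have ht3 : L ≤ t ^ 3 := by
    rw [ht, ← Real.rpow_natCast, ← Real.rpow_mul hL0.le]
    calc L = L ^ (1:ℝ) := (Real.rpow_one L).symm
      _ ≤ _ := Real.rpow_le_rpow_of_exponent_le hL (by push_cast; linarith)
  have h2 : 2 * t ≤ t / (1 - α) := by
    rw [le_div_iff₀ (by linarith)]
    nlinarith
  have h3 : L - K ^ 3 ≤ t ^ 2 * (t / (1 - α) - K) := by
    have h4 : t ^ 2 * (2 * t - K) ≤ t ^ 2 * (t / (1 - α) - K) := by gcongr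
    refine le_trans ?_ h4
    rcases le_total K t with h | h
    · nlinarith [mul_nonneg (sq_nonneg t) (sub_nonneg.2 h), pow_nonneg hK 3]
    · have : t ^ 2 ≤ K ^ 2 := by gcongr
      nlinarith [mul_le_mul_of_nonneg_left this hK]
  rw [hu, show 1 / L - K ^ 3 / L ^ 2 = (L - K ^ 3) / L ^ 2 by field_simp,
    show (t / L) ^ 2 * (t / (1 - α) - K) = t ^ 2 * (t / (1 - α) - K) / L ^ 2 by ring]
  gcongr

/-- A function of the radius with an explicit antiderivative, bounding the radial density of the
cubic integral from below. -/
noncomputable def lowerDensity (D r : ℝ) : ℝ :=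
  r⁻¹ * (1 / (-Real.log r) - D / (-Real.log r) ^ 2)

lemma hasDerivAt_lowerDensity (D : ℝ) {r : ℝ} (hr : 0 < r) (hr3 : r ≤ 1/3) :
    HasDerivAt (fun r => -Real.log (-Real.log r) - D * (-Real.log r)⁻¹) (lowerDensity D r) r := by
  have hL : -Real.log r ≠ 0 := by linarith [one_le_neg_log hr hr3]
  have h := (Real.hasDerivAt_log hr.ne').neg
  refine ((h.log hL).neg.sub ((h.inv hL).const_mul D)).congr_deriv ?_
  simp only [lowerDensity, Pi.neg_apply]
  have : Real.log r ≠ 0 := by simpa using hL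
  field_simp

lemma continuousOn_lowerDensity (D : ℝ) {a : ℝ} (ha : 0 < a) :
    ContinuousOn (lowerDensity D) (Set.Icc a (1/3)) := fun r hr => by
  have hr0 := ha.trans_le hr.1
  have hL : -Real.log r ≠ 0 := by linarith [one_le_neg_log hr0 hr.2]
  have hc := (Real.continuousAt_log hr0.ne').neg
  exact ((continuousAt_inv₀ hr0.ne').mul ((continuousAt_const.div hc hL).sub
    (continuousAt_const.div (hc.pow 2) (pow_ne_zero 2 hL)))).continuousWithinAt

lemma integral_lowerDensity (D : ℝ) {n : ℕ} (hn : 3 ≤ n) :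
    ∫ r in Set.Ioo (1/(n:ℝ)) (1/3), lowerDensity D r =
      Real.log (Real.log n) + D * (Real.log n)⁻¹ -
        (Real.log (Real.log 3) + D * (Real.log 3)⁻¹) := by
  have hle : 1/(n:ℝ) ≤ 1/3 := one_div_le_one_div_of_le (by norm_num) (by exact_mod_cast hn)
  have hpos : 0 < 1/(n:ℝ) := by positivity
  rw [← integral_Ioc_eq_integral_Ioo, ← intervalIntegral.integral_of_le hle,
    intervalIntegral.integral_eq_sub_of_hasDerivAt
      (f := fun r => -Real.log (-Real.log r) - D * (-Real.log r)⁻¹)]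
  · simp only [one_div, Real.log_inv, neg_neg]
    ring
  · intro r hr
    rw [Set.uIcc_of_le hle] at hr
    exact hasDerivAt_lowerDensity D (hpos.trans_le hr.1) hr.2
  · refine ContinuousOn.intervalIntegrable ?_
    rw [Set.uIcc_of_le hle]
    exact continuousOn_lowerDensity D hpos

lemma lowerDensity_le {α : ℝ} (hα1 : 1/2 < α) (hα2 : α ≤ 2/3) {n : ℕ} (hn : 3 ≤ n) {r : ℝ}
    (hr : r ∈ Set.Ioo (1/(n:ℝ)) (1/3)) :
    lowerDensity (((-Real.log (1/3)) ^ (1 - α) / (1 - α) + 1) ^ 3) r ≤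
      r * (profileN α n r ^ 2 * meanVelocity (profileN α n) r) := by
  have hα0 : 0 ≤ α := by linarith
  have hr0 : 0 < r := lt_trans (by positivity) hr.1
  have hL := one_le_neg_log hr0 hr.2.le
  have h3 := one_le_neg_log (r := 1/3) (by norm_num) le_rfl
  set K := (-Real.log (1/3)) ^ (1 - α) / (1 - α) + 1 with hK
  have hK0 : 0 ≤ K :=
    add_nonneg (div_nonneg (Real.rpow_nonneg (by linarith) _) (by linarith)) zero_le_one
  have hJ := le_meanVelocity (b := 1/3) (measurable_profileN α n) (norm_profileN_le hα0 hn)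
    (profileN_eq_zero hn) profileN_nonneg (fun _ => mul_profileN_le hα0 hn) hr0
  rw [integral_profileN (by linarith) hn ⟨hr.1.le, hr.2⟩, sub_div, sub_sub, ← hK] at hJ
  have hb := (log_weight_lower_bound hα1 hα2 hK0 hL).trans
    (mul_le_mul_of_nonneg_left hJ (sq_nonneg _))
  rw [profileN_of_mem (by omega) ⟨hr.1.le, hr.2⟩, lowerDensity]
  refine (mul_le_mul_of_nonneg_left hb (inv_pos.2 hr0).le).trans_eq ?_
  field_simp

lemma le_integral_vel_mul_sq {α : ℝ} (hα1 : 1/2 < α) (hα2 : α ≤ 2/3) {n : ℕ} (hn : 3 ≤ n) :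
    -1 + ∫ r in Set.Ioo (1/(n:ℝ)) (1/3),
        lowerDensity (((-Real.log (1/3)) ^ (1 - α) / (1 - α) + 1) ^ 3) r ≤
      ∫ x, vel (omegaN α n) x 0 * omegaN α n x ^ 2 := by
  set D := ((-Real.log (1/3)) ^ (1 - α) / (1 - α) + 1) ^ 3 with hD
  have hα0 : 0 ≤ α := by linarith
  have hn0 : (0:ℝ) < n := by positivity
  have hpos : 0 < 1/(n:ℝ) := by positivity
  have hle : 1/(n:ℝ) ≤ 1/3 := one_div_le_one_div_of_le (by norm_num) (by exact_mod_cast hn)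
  obtain ⟨hint, heq⟩ := integral_vel_mul_sq_eq_meanVelocity (measurable_profileN α n)
    (norm_profileN_le hα0 hn) (profileN_eq_zero hn)
  set F := fun r => r * (profileN α n r ^ 2 * meanVelocity (profileN α n) r) with hF
  have hJ : ∀ r, 0 < r → -1 ≤ meanVelocity (profileN α n) r := fun r hr => by
    simpa using le_meanVelocity (b := r) (measurable_profileN α n) (norm_profileN_le hα0 hn)
      (profileN_eq_zero hn) profileN_nonneg (fun _ => mul_profileN_le hα0 hn) hr
  have hzero : ∀ r, r ∉ Set.Ico (1/(n:ℝ)) (1/3) → 1/(n:ℝ) ≤ r → F r = 0 := fun r hr h => by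
    have h3 : ¬ r < 1/3 := fun h' => hr ⟨h, h'⟩
    simp only [hF, profileN, if_neg h.not_gt, if_neg h3]
    ring
  have hsplit : ∫ r in Set.Ioi 0, F r =
      (∫ r in Set.Ioc 0 (1/(n:ℝ)), F r) + ∫ r in Set.Ioo (1/(n:ℝ)) (1/3), F r := by
    rw [← setIntegral_union (Set.disjoint_left.2 fun r h h' => h'.1.not_ge h.2) measurableSet_Ioo
      (hint.mono_set Set.Ioc_subset_Ioi_self)
      (hint.mono_set fun r hr => hpos.trans hr.1)]
    refine setIntegral_eq_of_subset_of_forall_sdiff_eq_zero measurableSet_Ioi ?_ ?_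
    · rintro r (hr | hr)
      · exact hr.1
      · exact hpos.trans hr.1
    · rintro r ⟨hr0, hr⟩
      have h1 : 1/(n:ℝ) < r := by
        by_contra! h; exact hr (Or.inl ⟨hr0, h⟩)
      exact hzero r (fun h => hr (Or.inr ⟨h1, h.2⟩)) h1.le
  rw [omegaN_eq_halfRadial, heq, hsplit]
  gcongr ?_ + ?_
  · have h1 : ∫ r in Set.Ioc 0 (1/(n:ℝ)), -(n:ℝ) = -1 := by
      simp [hn0.ne', hn0.le]
    rw [← h1]
    refine setIntegral_mono_on (integrableOn_const measure_Ioc_lt_top.ne)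
      (hint.mono_set Set.Ioc_subset_Ioi_self) measurableSet_Ioc fun r hr => ?_
    have hp := profileN_nonneg (α := α) (n := n) r
    have h2 : r * profileN α n r ^ 2 ≤ n :=
      calc r * profileN α n r ^ 2 = (r * profileN α n r) * profileN α n r := by ring
        _ ≤ 1 * n := mul_le_mul (mul_profileN_le hα0 hn hr.1) (profileN_le hα0 hn r) hp zero_le_one
        _ = n := one_mul _
    have h3 : 0 ≤ r * profileN α n r ^ 2 := mul_nonneg hr.1.le (sq_nonneg _)
    have h4 := mul_le_mul_of_nonneg_left (hJ r hr.1) h3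
    simp only [hF]
    linarith
  · refine setIntegral_mono_on ?_ (hint.mono_set fun r hr => hpos.trans hr.1) measurableSet_Ioo
      fun r hr => lowerDensity_le hα1 hα2 hn hr
    exact ((continuousOn_lowerDensity D hpos).integrableOn_Icc).mono_set Set.Ioo_subset_Icc_self

/-- for `1/2 < α ≤ 2/3`, with `u^n₁` the first component of `K ∗ ω^n_+`,
the integrals `∫ u^n₁ |ω^n_+|²` tend to `+∞` as `n → ∞`. -/
theorem truncated_cubic_integral_blows_up (α : ℝ) (hα1 : 1/2 < α) (hα2 : α ≤ 2/3) :
    Tendsto (fun n : ℕ => ∫ x : E2, vel (omegaN α n) x 0 * omegaN α n x ^ 2)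
      atTop atTop := by
  set D := ((-Real.log (1/3)) ^ (1 - α) / (1 - α) + 1) ^ 3 with hD
  have hD0 : 0 ≤ D := by
    have h3 := one_le_neg_log (r := 1/3) (by norm_num) le_rfl
    exact pow_nonneg (add_nonneg (div_nonneg (Real.rpow_nonneg (by linarith) _) (by linarith))
      zero_le_one) 3
  have hlim : Tendsto (fun n : ℕ => Real.log (Real.log n) +
      (-1 - (Real.log (Real.log 3) + D * (Real.log 3)⁻¹))) atTop atTop :=
    tendsto_atTop_add_const_right _ _ (Real.tendsto_log_atTop.comp
      (Real.tendsto_log_atTop.comp tendsto_natCast_atTop_atTop))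
  refine tendsto_atTop_mono' _ ?_ hlim
  filter_upwards [eventually_ge_atTop 3] with n hn
  have h := le_integral_vel_mul_sq hα1 hα2 hn
  rw [← hD, integral_lowerDensity D hn] at h
  have : 0 ≤ D * (Real.log n)⁻¹ :=
    mul_nonneg hD0 (inv_nonneg.2 (Real.log_natCast_nonneg n))
  linarith
end

section
/- Let ω₀(x) = φ(x)/|x| with φ as specified. For every η > 0 there exists a constant C > 0 such that for every λ > 0 and every x ∈ ℝ² with |x| ≥ η, the gradient of the heat regularization satisfies |∇(G_λ ∗ ω₀)(x)| ≤ C; that is, ∇(G_λ ∗ ω₀) is bounded on the complement of B(0;η), uniformly in λ > 0. -/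
open MeasureTheory Real Metric Filter
open scoped ENNReal Topology

/-- The two-dimensional heat kernel `G_λ(x) = (4πλ)⁻¹ e^{-|x|²/(4λ)}`. -/
noncomputable def heatKer (l : ℝ) (x : E2) : ℝ :=
  (4 * Real.pi * l)⁻¹ * Real.exp (-‖x‖ ^ 2 / (4 * l))

/-- The heat regularization `(G_λ ∗ f)(x) = ∫ G_λ(x-y) f(y) dy`. -/
noncomputable def heatConv (l : ℝ) (f : E2 → ℝ) (x : E2) : ℝ :=
  ∫ y, heatKer l (x - y) * f y

/-- The vorticity `ω₀(x) = φ(x)/|x|`. -/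
noncomputable def omega0 (φ : E2 → ℝ) (x : E2) : ℝ := φ x / ‖x‖

lemma heatKer_nonneg {l : ℝ} (hl : 0 < l) (z : E2) : 0 ≤ heatKer l z := by
  unfold heatKer; positivity

lemma heatKer_le {l : ℝ} (hl : 0 < l) (z : E2) : heatKer l z ≤ (4 * Real.pi * l)⁻¹ := by
  unfold heatKer
  refine mul_le_of_le_one_right (by positivity) (Real.exp_le_one_iff.2 ?_)
  exact div_nonpos_of_nonpos_of_nonneg (by simp) (by positivity)

lemma continuous_heatKer (l : ℝ) : Continuous (heatKer l) := by
  unfold heatKer; fun_prop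

lemma integral_heatKer {l : ℝ} (hl : 0 < l) : ∫ z, heatKer l z = 1 := by
  have h := GaussianFourier.integral_rexp_neg_mul_sq_norm (V := E2) (b := 1 / (4 * l))
    (by positivity)
  have e : ∀ z : E2, heatKer l z
      = (4 * Real.pi * l)⁻¹ * Real.exp (-(1 / (4 * l)) * ‖z‖ ^ 2) := fun z ↦ by
    unfold heatKer; congr 2; ring
  simp_rw [e]
  rw [integral_const_mul, h]
  have hpi := Real.pi_pos
  simp
  field_simp

lemma integrable_heatKer {l : ℝ} (hl : 0 < l) : Integrable (heatKer l) :=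
  Integrable.of_integral_ne_zero (by rw [integral_heatKer hl]; exact one_ne_zero)

lemma integrable_heatKer_sub_mul {l : ℝ} (hl : 0 < l) {f : E2 → ℝ} (hf : Integrable f) (x : E2) :
    Integrable fun y ↦ heatKer l (x - y) * f y := by
  refine hf.bdd_mul (c := (4 * Real.pi * l)⁻¹) ?_ (ae_of_all _ fun y ↦ ?_)
  · exact ((continuous_heatKer l).comp (by fun_prop)).aestronglyMeasurable
  · rw [Real.norm_of_nonneg (heatKer_nonneg hl _)]
    exact heatKer_le hl _

lemma heatConv_add {l : ℝ} (hl : 0 < l) {f g : E2 → ℝ} (hf : Integrable f) (hg : Integrable g)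
    (x : E2) : heatConv l (fun y ↦ f y + g y) x = heatConv l f x + heatConv l g x := by
  unfold heatConv
  simp_rw [mul_add]
  exact integral_add (integrable_heatKer_sub_mul hl hf x) (integrable_heatKer_sub_mul hl hg x)

/-- Heat regularization does not increase the Lipschitz constant. -/
lemma abs_heatConv_sub_le_of_lipschitz {l : ℝ} (hl : 0 < l) {f : E2 → ℝ} (hf : Integrable f)
    {L : ℝ} (hL : ∀ x y, |f x - f y| ≤ L * ‖x - y‖) (x y : E2) :
    |heatConv l f x - heatConv l f y| ≤ L * ‖x - y‖ := by
  have hint : ∀ x : E2, Integrable fun z ↦ heatKer l z * f (x - z) := fun x ↦ by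
    simpa using (integrable_heatKer_sub_mul hl hf x).comp_sub_left x
  have e : ∀ x : E2, heatConv l f x = ∫ z, heatKer l z * f (x - z) := fun x ↦ by
    unfold heatConv
    rw [← integral_sub_left_eq_self _ volume x]
    simp
  rw [e, e, ← integral_sub (hint x) (hint y), ← Real.norm_eq_abs]
  refine (norm_integral_le_of_norm_le ((integrable_heatKer hl).mul_const (L * ‖x - y‖))
    (ae_of_all _ fun z ↦ ?_)).trans_eq ?_
  · rw [← mul_sub, norm_mul, Real.norm_of_nonneg (heatKer_nonneg hl z), Real.norm_eq_abs]
    refine mul_le_mul_of_nonneg_left ?_ (heatKer_nonneg hl z)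
    simpa using hL (x - z) (y - z)
  · rw [integral_mul_const, integral_heatKer hl, one_mul]

/-- Away from the origin, the heat kernel is Lipschitz uniformly in time. -/
lemma abs_heatKer_sub_le {l d : ℝ} (hl : 0 < l) (hd : 0 < d) {z w : E2} (hz : d ≤ ‖z‖)
    (hw : d ≤ ‖w‖) :
    |heatKer l z - heatKer l w| ≤ 4 / (Real.pi * d ^ 3) * ‖z - w‖ := by
  have hpi := Real.pi_pos
  have hder : ∀ r ∈ Set.Ici d, HasDerivWithinAt
      (fun r : ℝ ↦ (4 * Real.pi * l)⁻¹ * Real.exp (-r ^ 2 / (4 * l)))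
      ((4 * Real.pi * l)⁻¹ * (Real.exp (-r ^ 2 / (4 * l)) * (-(2 * r) / (4 * l))))
      (Set.Ici d) r := fun r _ ↦ by
    have h : HasDerivAt (fun r : ℝ ↦ -r ^ 2 / (4 * l)) (-(2 * r) / (4 * l)) r := by
      simpa using ((hasDerivAt_pow 2 r).neg.div_const (4 * l))
    exact (h.exp.const_mul _).hasDerivWithinAt
  have hbd : ∀ r ∈ Set.Ici d,
      ‖(4 * Real.pi * l)⁻¹ * (Real.exp (-r ^ 2 / (4 * l)) * (-(2 * r) / (4 * l)))‖
        ≤ 4 / (Real.pi * d ^ 3) := fun r hr ↦ by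
    have hr' : d ≤ r := hr
    have hr0 : 0 < r := hd.trans_le hr'
    set s := r ^ 2 / (4 * l) with hs
    have hs0 : 0 ≤ s := by positivity
    have hexp : s ^ 2 * Real.exp (-s) ≤ 2 := by
      rw [Real.exp_neg, ← div_eq_mul_inv, div_le_iff₀ (Real.exp_pos _)]
      linarith [Real.quadratic_le_exp_of_nonneg hs0]
    have e : ‖(4 * Real.pi * l)⁻¹ * (Real.exp (-r ^ 2 / (4 * l)) * (-(2 * r) / (4 * l)))‖
        = 2 * (s ^ 2 * Real.exp (-s)) / (Real.pi * r ^ 3) := by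
      have e1 : -r ^ 2 / (4 * l) = -s := by rw [hs]; ring
      rw [e1, neg_div, mul_neg, mul_neg, norm_neg, Real.norm_of_nonneg (by positivity), hs]
      field_simp
    rw [e]
    calc 2 * (s ^ 2 * Real.exp (-s)) / (Real.pi * r ^ 3)
        ≤ 4 / (Real.pi * r ^ 3) := by gcongr; linarith
      _ ≤ 4 / (Real.pi * d ^ 3) := by gcongr
  have h := (convex_Ici d).norm_image_sub_le_of_norm_hasDerivWithin_le hder hbd
    (show ‖w‖ ∈ Set.Ici d from hw) (show ‖z‖ ∈ Set.Ici d from hz)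
  exact h.trans (mul_le_mul_of_nonneg_left (abs_norm_sub_norm_le z w) (by positivity))

/-- At distance at least `d` from the support of `f`, the heat regularization of `f` is Lipschitz
uniformly in time. -/
lemma abs_heatConv_sub_le_of_support {l d : ℝ} (hl : 0 < l) (hd : 0 < d) {f : E2 → ℝ}
    (hf : Integrable f) {x y : E2} (hx : ∀ z, f z ≠ 0 → d ≤ ‖x - z‖)
    (hy : ∀ z, f z ≠ 0 → d ≤ ‖y - z‖) :
    |heatConv l f x - heatConv l f y| ≤ 4 / (Real.pi * d ^ 3) * (∫ z, |f z|) * ‖x - y‖ := by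
  unfold heatConv
  rw [← integral_sub (integrable_heatKer_sub_mul hl hf x) (integrable_heatKer_sub_mul hl hf y),
    ← Real.norm_eq_abs]
  refine (norm_integral_le_of_norm_le (hf.abs.const_mul (4 / (Real.pi * d ^ 3) * ‖x - y‖))
    (ae_of_all _ fun z ↦ ?_)).trans_eq ?_
  · rw [← sub_mul, norm_mul, Real.norm_eq_abs, Real.norm_eq_abs]
    by_cases hz : f z = 0
    · simp [hz]
    · refine mul_le_mul_of_nonneg_right ?_ (abs_nonneg _)
      simpa using abs_heatKer_sub_le hl hd (hx z hz) (hy z hz)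
  · rw [integral_const_mul]; ring

lemma norm_gradient_le_of_lip' {f : E2 → ℝ} {x : E2} {C : ℝ} (hC : 0 ≤ C)
    (h : ∀ᶠ y in 𝓝 x, ‖f y - f x‖ ≤ C * ‖y - x‖) : ‖gradient f x‖ ≤ C := by
  unfold gradient
  rw [LinearIsometryEquiv.norm_map]
  exact norm_fderiv_le_of_lip' ℝ hC h

lemma integrable_omega0 {φ : E2 → ℝ} (hφ : Continuous φ) (hφcpt : HasCompactSupport φ) :
    Integrable (omega0 φ) := by
  obtain ⟨M, hM⟩ := hφcpt.exists_bound_of_continuous hφ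
  have hmeas : AEStronglyMeasurable (omega0 φ) volume :=
    (hφ.measurable.div measurable_norm).aestronglyMeasurable
  have hloc : LocallyIntegrable (omega0 φ) volume := by
    refine locallyIntegrable_of_norm_le_rpow (C := M) (α := 1) (by simp) (by simp)
      (ae_of_all _ fun x ↦ ?_) hmeas
    rw [omega0, norm_div, norm_norm, Real.rpow_neg_one, div_eq_mul_inv]
    exact mul_le_mul_of_nonneg_right (hM x) (by positivity)
  refine (integrableOn_iff_integrable_of_support_subset ?_).1
    (hloc.integrableOn_isCompact hφcpt)
  intro x hx
  refine subset_tsupport φ fun h ↦ hx ?_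
  simp [omega0, h]

lemma exists_lipschitz_div_max_norm {φ : E2 → ℝ} (hφ : ContDiff ℝ 1 φ)
    (hφcpt : HasCompactSupport φ) {r : ℝ} (hr : 0 < r) :
    ∃ L : ℝ, 0 ≤ L ∧ ∀ x y : E2,
      |φ x / max ‖x‖ r - φ y / max ‖y‖ r| ≤ L * ‖x - y‖ := by
  obtain ⟨K, hK⟩ := hφ.lipschitzWith_of_hasCompactSupport hφcpt one_ne_zero
  obtain ⟨M, hM⟩ := hφcpt.exists_bound_of_continuous hφ.continuous
  have hM0 : 0 ≤ M := (norm_nonneg _).trans (hM 0)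
  refine ⟨K / r + M / (r * r), by positivity, fun x y ↦ ?_⟩
  have ha : r ≤ max ‖x‖ r := le_max_right _ _
  have hb : r ≤ max ‖y‖ r := le_max_right _ _
  have hab : |max ‖y‖ r - max ‖x‖ r| ≤ ‖x - y‖ := by
    refine (abs_max_sub_max_le_abs _ _ _).trans ?_
    rw [norm_sub_rev]
    exact abs_norm_sub_norm_le y x
  have hφxy : |φ x - φ y| ≤ K * ‖x - y‖ := by
    simpa [dist_eq_norm] using hK.dist_le_mul x y
  set a := max ‖x‖ r
  set b := max ‖y‖ r
  have ha0 : 0 < a := hr.trans_le ha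
  have hb0 : 0 < b := hr.trans_le hb
  have e : φ x / a - φ y / b = (φ x - φ y) / a + φ y * (b - a) / (a * b) := by
    field_simp; ring
  rw [e, add_mul]
  refine (abs_add_le _ _).trans (add_le_add ?_ ?_)
  · rw [abs_div, abs_of_pos ha0, div_mul_eq_mul_div]
    gcongr
  · rw [abs_div, abs_mul, abs_of_pos (mul_pos ha0 hb0), div_mul_eq_mul_div]
    have := hM y
    rw [Real.norm_eq_abs] at this
    gcongr

/-- for every `η > 0` there is `C > 0` such that `|∇(G_λ ∗ ω₀)(x)| ≤ C`
for all `λ > 0` and all `|x| ≥ η`. -/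
theorem heat_gradient_bounded_away_from_origin
    (φ : E2 → ℝ) (hφsm : ContDiff ℝ (⊤ : ℕ∞) φ) (hφcpt : HasCompactSupport φ)
    (hφsupp : tsupport φ ⊆ ball (0 : E2) 1)
    (hφrad : ∃ g : ℝ → ℝ, ∀ x, φ x = g ‖x‖)
    (hφone : ∀ x : E2, ‖x‖ < 1/2 → φ x = 1) :
    ∀ η : ℝ, 0 < η → ∃ C : ℝ, 0 < C ∧ ∀ l : ℝ, 0 < l → ∀ x : E2, η ≤ ‖x‖ →
      ‖gradient (heatConv l (omega0 φ)) x‖ ≤ C := by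
  intro η hη
  have hr : 0 < η / 2 := by positivity
  set g : E2 → ℝ := fun x ↦ φ x / max ‖x‖ (η / 2) with hg
  set f : E2 → ℝ := fun x ↦ omega0 φ x - g x with hf
  have hcont : Continuous φ := hφsm.continuous
  have hgi : Integrable g := by
    refine Continuous.integrable_of_hasCompactSupport ?_ ?_
    · exact hcont.div (by fun_prop) fun x ↦ (hr.trans_le (le_max_right _ _)).ne'
    · refine hφcpt.mono fun x hx h ↦ hx ?_
      simp [hg, h]
  have hfi : Integrable f := (integrable_omega0 hcont hφcpt).sub hgi
  have hfsupp : ∀ z, f z ≠ 0 → ‖z‖ < η / 2 := fun z hz ↦ by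
    by_contra! h
    exact hz (by simp [hf, hg, omega0, max_eq_left h])
  have hsplit : omega0 φ = fun y ↦ f y + g y := by
    ext y; simp [hf]
  obtain ⟨L, hL0, hL⟩ := exists_lipschitz_div_max_norm
    (hφsm.of_le (by exact_mod_cast le_top)) hφcpt hr
  have hK : 0 ≤ 4 / (Real.pi * (η / 4) ^ 3) * ∫ z, |f z| :=
    mul_nonneg (by have := Real.pi_pos; positivity) (integral_nonneg fun _ ↦ abs_nonneg _)
  refine ⟨4 / (Real.pi * (η / 4) ^ 3) * (∫ z, |f z|) + L + 1, by positivity,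
    fun l hl x hx ↦ ?_⟩
  refine (norm_gradient_le_of_lip' (add_nonneg hK hL0) ?_).trans (by linarith)
  filter_upwards [ball_mem_nhds x (show 0 < η / 4 by positivity)] with y hy
  rw [mem_ball, dist_eq_norm, norm_sub_rev] at hy
  have hd : ∀ w : E2, ‖x - w‖ < η / 4 → ∀ z, f z ≠ 0 → η / 4 ≤ ‖w - z‖ := fun w hw z hz ↦ by
    have h1 := hfsupp z hz
    have h2 := norm_sub_norm_le x z
    have h3 := norm_sub_le_norm_sub_add_norm_sub x w z
    linarith
  have h1 := abs_heatConv_sub_le_of_support hl (by positivity) hfi (hd y hy)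
    (hd x (by simpa using hη))
  have h2 := abs_heatConv_sub_le_of_lipschitz hl hgi hL y x
  rw [hsplit, heatConv_add hl hfi hgi, heatConv_add hl hfi hgi, add_sub_add_comm, add_mul]
  exact (abs_add_le _ _).trans (add_le_add h1 h2)
end

section
/- Let ω₀(x) = φ(x)/|x| with φ as specified. There exists a constant c > 0 (independent of t and f) such that for every t > 0 and every test function f ∈ C_c^∞(ℝ²), lim_{ν → 0⁺} ∫_{ℝ²} ν |∇(G_{νt} ∗ ω₀)(x)|² f(x) dx = (c/t) f(0). In other words, the viscous enstrophy defect Z^V(ω₀) exists and equals (c/t) δ₀, a nonzero multiple of the Dirac measure at the origin. -/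
open MeasureTheory Real Metric Filter
open scoped ENNReal Topology

/-- The polynomial weight `(1 + |w|)⁻³`, which is integrable on the plane. -/
noncomputable def cubicDecay (w : E2) : ℝ := ((1 + ‖w‖) ^ 3)⁻¹

/-- The weight `(1 + |ξ - z|)⁻³ (1 + |z|⁻¹)`, which dominates the convolution integrands. -/
noncomputable def singularWeight (ξ z : E2) : ℝ := cubicDecay (ξ - z) * (1 + ‖z‖⁻¹)

lemma cubicDecay_nonneg (w : E2) : 0 ≤ cubicDecay w := by
  unfold cubicDecay; positivity

lemma cubicDecay_le_one (w : E2) : cubicDecay w ≤ 1 := by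
  unfold cubicDecay
  exact inv_le_one_of_one_le₀ (one_le_pow₀ (by linarith [norm_nonneg w]))

lemma singularWeight_nonneg (ξ z : E2) : 0 ≤ singularWeight ξ z := by
  have := cubicDecay_nonneg (ξ - z)
  unfold singularWeight; positivity

lemma continuous_cubicDecay : Continuous cubicDecay := by
  unfold cubicDecay
  exact Continuous.inv₀ (by fun_prop) (fun w => by positivity)

lemma measurable_singularWeight (ξ : E2) : Measurable (singularWeight ξ) := by
  unfold singularWeight
  have := continuous_cubicDecay.measurable
  fun_prop

lemma integrable_inv_one_add_norm_pow {k : ℕ} (hk : 2 < k) :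
    Integrable (fun w : E2 => ((1 + ‖w‖) ^ k)⁻¹) := by
  have h := integrable_one_add_norm (E := E2) (μ := volume) (r := (k : ℝ))
    (by simpa using hk)
  refine h.congr (Eventually.of_forall fun w => ?_)
  simp only
  rw [Real.rpow_neg (by positivity), Real.rpow_natCast]

lemma integrable_cubicDecay : Integrable cubicDecay :=
  integrable_inv_one_add_norm_pow (by norm_num)

lemma integrable_indicator_inv_norm :
    Integrable (fun z : E2 => (Set.Iio (1 : ℝ)).indicator (fun r => r⁻¹) ‖z‖) := by
  rw [integrable_fun_norm_addHaar (volume : Measure E2)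
    (f := (Set.Iio (1 : ℝ)).indicator (fun r => r⁻¹))]
  have h : IntegrableOn ((Set.Iio (1 : ℝ)).indicator fun _ => (1 : ℝ)) (Set.Ioi 0) := by
    rw [IntegrableOn, integrable_indicator_iff measurableSet_Iio, IntegrableOn,
      Measure.restrict_restrict measurableSet_Iio]
    refine integrableOn_const (by simp [Set.Iio_inter_Ioi]) (by simp)
  refine h.congr_fun (fun r hr => ?_) measurableSet_Ioi
  have hr0 : (r : ℝ) ≠ 0 := ne_of_gt hr
  by_cases h1 : r < 1 <;> simp [Set.indicator, h1, hr0]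

lemma singularWeight_le (ξ z : E2) :
    singularWeight ξ z ≤
      (Set.Iio (1 : ℝ)).indicator (fun r => r⁻¹) ‖z‖ + 2 * cubicDecay (ξ - z) := by
  have h0 := cubicDecay_nonneg (ξ - z)
  have h1 := cubicDecay_le_one (ξ - z)
  unfold singularWeight
  by_cases hz : ‖z‖ < 1
  · have : 0 ≤ ‖z‖⁻¹ := by positivity
    simp only [Set.indicator, Set.mem_Iio, hz, if_true]
    nlinarith
  · have : ‖z‖⁻¹ ≤ 1 := inv_le_one_of_one_le₀ (not_lt.1 hz)
    simp only [Set.indicator, Set.mem_Iio, hz, if_false]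
    nlinarith

lemma integrable_singularWeight (ξ : E2) : Integrable (singularWeight ξ) := by
  refine (integrable_indicator_inv_norm.add
    ((integrable_cubicDecay.comp_sub_left ξ).const_mul 2)).mono'
    (measurable_singularWeight ξ).aestronglyMeasurable (Eventually.of_forall fun z => ?_)
  rw [Real.norm_of_nonneg (singularWeight_nonneg ξ z)]
  exact singularWeight_le ξ z

lemma exists_integral_singularWeight_le :
    ∃ C : ℝ, 0 ≤ C ∧ ∀ ξ, ∫ z, singularWeight ξ z ≤ C := by
  have key : ∀ ξ, ∫ z, singularWeight ξ z ≤
      (∫ z : E2, (Set.Iio (1 : ℝ)).indicator (fun r => r⁻¹) ‖z‖) +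
        2 * ∫ w, cubicDecay w := by
    intro ξ
    have hi := (integrable_cubicDecay.comp_sub_left ξ).const_mul 2
    refine (integral_mono (integrable_singularWeight ξ)
      (integrable_indicator_inv_norm.add hi) (singularWeight_le ξ)).trans_eq ?_
    rw [← integral_sub_left_eq_self cubicDecay volume ξ, ← integral_const_mul]
    exact integral_add integrable_indicator_inv_norm hi
  exact ⟨_, (integral_nonneg (singularWeight_nonneg 0)).trans (key 0), key⟩

lemma cubicDecay_le_of_norm_sub_le {v w : E2} (h : ‖v - w‖ ≤ 1) :
    cubicDecay w ≤ 8 * cubicDecay v := by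
  have h1 : 1 + ‖v‖ ≤ 2 * (1 + ‖w‖) := by
    have := norm_sub_norm_le v w
    linarith [norm_nonneg w]
  have h2 : (1 + ‖v‖) ^ 3 ≤ 8 * (1 + ‖w‖) ^ 3 := by
    calc (1 + ‖v‖) ^ 3 ≤ (2 * (1 + ‖w‖)) ^ 3 := by gcongr
      _ = _ := by ring
  unfold cubicDecay
  rw [← div_eq_mul_inv, inv_eq_one_div, div_le_div_iff₀ (by positivity) (by positivity)]
  linarith

lemma singularWeight_le_of_norm_sub_le {ξ η : E2} (h : ‖η - ξ‖ ≤ 1) (z : E2) :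
    singularWeight η z ≤ 8 * singularWeight ξ z := by
  have : cubicDecay (η - z) ≤ 8 * cubicDecay (ξ - z) :=
    cubicDecay_le_of_norm_sub_le (by rwa [sub_sub_sub_cancel_right, norm_sub_rev])
  unfold singularWeight
  rw [← mul_assoc]
  gcongr

/-- The gradient of the heat kernel at time one. -/
noncomputable def gradHeatKer (w : E2) : E2 := -(heatKer 1 w / 2) • w

lemma heatKer_one_pos (w : E2) : 0 < heatKer 1 w := by
  unfold heatKer; positivity

lemma continuous_gradHeatKer : Continuous gradHeatKer := by
  have := continuous_heatKer 1
  unfold gradHeatKer; fun_prop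

lemma gradHeatKer_neg (w : E2) : gradHeatKer (-w) = -gradHeatKer w := by
  simp [gradHeatKer, heatKer]

lemma norm_gradHeatKer (w : E2) : ‖gradHeatKer w‖ = ‖w‖ * heatKer 1 w / 2 := by
  rw [gradHeatKer, norm_smul, norm_neg, Real.norm_of_nonneg (by have := heatKer_one_pos w; positivity)]
  ring

lemma hasGradientAt_heatKer_one (w : E2) : HasGradientAt (heatKer 1) (gradHeatKer w) w := by
  rw [hasGradientAt_iff_hasFDerivAt]
  have h1 : HasFDerivAt (fun x : E2 => ‖x‖ ^ 2) (2 • innerSL ℝ w) w :=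
    (hasStrictFDerivAt_norm_sq w).hasFDerivAt
  have h2 := (((h1.neg).mul_const (4 * 1 : ℝ)⁻¹).exp).const_mul (4 * Real.pi * 1)⁻¹
  simp only [← div_eq_mul_inv] at h2
  refine h2.congr_fderiv ?_
  ext v
  simp [gradHeatKer, heatKer]
  ring

lemma exists_norm_pow_mul_heatKer_le :
    ∃ C : ℝ, 0 ≤ C ∧ ∀ (w : E2) (j : ℕ), j ≤ 3 → ‖w‖ ^ j * heatKer 1 w ≤ C * cubicDecay w := by
  refine ⟨(4 * Real.pi * 1)⁻¹ * (720 * Real.exp 2), by positivity, fun w j hj => ?_⟩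
  have hr := norm_nonneg w
  have h1 := Real.pow_div_factorial_le_exp (1 + ‖w‖) (by positivity) 6
  have h2 : (1 + ‖w‖) ^ 6 ≤ 720 * Real.exp (1 + ‖w‖) := by
    rw [div_le_iff₀ (by positivity)] at h1
    norm_num [Nat.factorial] at h1
    linarith
  have h3 : Real.exp (1 + ‖w‖) * Real.exp (-‖w‖ ^ 2 / (4 * 1)) ≤ Real.exp 2 := by
    rw [← Real.exp_add]
    refine Real.exp_le_exp.2 ?_
    nlinarith [sq_nonneg (‖w‖ - 2)]
  have h4 : ‖w‖ ^ j ≤ (1 + ‖w‖) ^ 3 :=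
    (pow_le_pow_left₀ hr (by linarith) j).trans (pow_le_pow_right₀ (by linarith) hj)
  have hE := Real.exp_pos (-‖w‖ ^ 2 / (4 * 1))
  unfold cubicDecay heatKer
  rw [← div_eq_mul_inv, le_div_iff₀ (by positivity)]
  calc ‖w‖ ^ j * ((4 * Real.pi * 1)⁻¹ * Real.exp (-‖w‖ ^ 2 / (4 * 1))) * (1 + ‖w‖) ^ 3
      ≤ (1 + ‖w‖) ^ 3 * ((4 * Real.pi * 1)⁻¹ * Real.exp (-‖w‖ ^ 2 / (4 * 1))) * (1 + ‖w‖) ^ 3 := by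
        gcongr
    _ = (4 * Real.pi * 1)⁻¹ * ((1 + ‖w‖) ^ 6 * Real.exp (-‖w‖ ^ 2 / (4 * 1))) := by ring
    _ ≤ (4 * Real.pi * 1)⁻¹ *
        (720 * Real.exp (1 + ‖w‖) * Real.exp (-‖w‖ ^ 2 / (4 * 1))) := by gcongr
    _ ≤ (4 * Real.pi * 1)⁻¹ * (720 * Real.exp 2) := by
        rw [mul_assoc 720]; gcongr

lemma norm_div_norm_le (ξ z : E2) : ‖ξ‖ * ‖z‖⁻¹ ≤ ‖ξ - z‖ * ‖z‖⁻¹ + 1 := by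
  have h1 : ‖ξ‖ ≤ ‖ξ - z‖ + ‖z‖ := norm_le_norm_sub_add ξ z
  have h2 : ‖z‖ * ‖z‖⁻¹ ≤ 1 := mul_inv_le_one
  nlinarith [mul_le_mul_of_nonneg_right h1 (inv_nonneg.2 (norm_nonneg z))]

/-- The candidate gradient of `G₁ ∗ h`, obtained by differentiating the heat kernel. -/
noncomputable def gradConv (h : E2 → ℝ) (ξ : E2) : E2 := ∫ z, h z • gradHeatKer (ξ - z)

section Potential

variable {h : E2 → ℝ} {M : ℝ}

lemma exists_norm_smul_gradHeatKer_le (M : ℝ) (hM : 0 ≤ M) :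
    ∃ C : ℝ, 0 ≤ C ∧ ∀ h : E2 → ℝ, (∀ z, |h z| ≤ M * ‖z‖⁻¹) → ∀ ξ z,
      ‖h z • gradHeatKer (ξ - z)‖ ≤ C * singularWeight ξ z := by
  obtain ⟨C, hC0, hC⟩ := exists_norm_pow_mul_heatKer_le
  refine ⟨M * C, by positivity, fun h hh ξ z => ?_⟩
  have h1 := hC (ξ - z) 1 (by norm_num)
  rw [pow_one] at h1
  have h2 : 0 ≤ ‖ξ - z‖ * heatKer 1 (ξ - z) :=
    mul_nonneg (norm_nonneg _) (heatKer_one_pos _).le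
  have h3 := cubicDecay_nonneg (ξ - z)
  rw [norm_smul, norm_gradHeatKer, Real.norm_eq_abs, singularWeight]
  calc |h z| * (‖ξ - z‖ * heatKer 1 (ξ - z) / 2)
      ≤ (M * ‖z‖⁻¹) * (C * cubicDecay (ξ - z)) := by
        gcongr
        · exact hh z
        · linarith
    _ ≤ (M * (1 + ‖z‖⁻¹)) * (C * cubicDecay (ξ - z)) := by
        gcongr
        linarith
    _ = _ := by ring

lemma aestronglyMeasurable_smul_gradHeatKer (hm : Measurable h) (ξ : E2) :
    AEStronglyMeasurable (fun z => h z • gradHeatKer (ξ - z)) := by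
  have := continuous_gradHeatKer.measurable
  exact Measurable.aestronglyMeasurable (by fun_prop)

lemma integrable_smul_gradHeatKer (hm : Measurable h) (hM : 0 ≤ M)
    (hh : ∀ z, |h z| ≤ M * ‖z‖⁻¹) (ξ : E2) :
    Integrable (fun z => h z • gradHeatKer (ξ - z)) := by
  obtain ⟨C, -, hC⟩ := exists_norm_smul_gradHeatKer_le M hM
  exact ((integrable_singularWeight ξ).const_mul C).mono'
    (aestronglyMeasurable_smul_gradHeatKer hm ξ) (Eventually.of_forall (hC h hh ξ))

lemma continuous_gradConv (hm : Measurable h) (hM : 0 ≤ M)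
    (hh : ∀ z, |h z| ≤ M * ‖z‖⁻¹) : Continuous (gradConv h) := by
  obtain ⟨C, hC0, hC⟩ := exists_norm_smul_gradHeatKer_le M hM
  refine continuous_iff_continuousAt.2 fun ξ => ?_
  refine continuousAt_of_dominated (bound := fun z => C * (8 * singularWeight ξ z))
    (Eventually.of_forall (aestronglyMeasurable_smul_gradHeatKer hm)) ?_
    (((integrable_singularWeight ξ).const_mul 8).const_mul C)
    (Eventually.of_forall fun z => ?_)
  · filter_upwards [ball_mem_nhds ξ one_pos] with η hη
    refine Eventually.of_forall fun z => (hC h hh η z).trans ?_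
    gcongr
    exact singularWeight_le_of_norm_sub_le (mem_ball_iff_norm.1 hη).le z
  · have := continuous_gradHeatKer
    exact Continuous.continuousAt (by fun_prop)

lemma integrable_heatKer_mul (hm : Measurable h) (hh : ∀ z, |h z| ≤ M * ‖z‖⁻¹)
    (hM : 0 ≤ M) (ξ : E2) : Integrable (fun z => heatKer 1 (ξ - z) * h z) := by
  obtain ⟨C, hC0, hC⟩ := exists_norm_pow_mul_heatKer_le
  refine ((integrable_singularWeight ξ).const_mul (C * M)).mono' ?_
    (Eventually.of_forall fun z => ?_)
  · have := (continuous_heatKer 1).measurable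
    exact Measurable.aestronglyMeasurable (by fun_prop)
  · have h1 := hC (ξ - z) 0 (by norm_num)
    rw [pow_zero, one_mul] at h1
    have h3 := cubicDecay_nonneg (ξ - z)
    rw [norm_mul, Real.norm_of_nonneg (heatKer_one_pos _).le, Real.norm_eq_abs, singularWeight]
    calc heatKer 1 (ξ - z) * |h z| ≤ (C * cubicDecay (ξ - z)) * (M * ‖z‖⁻¹) := by
          gcongr
          exact hh z
      _ ≤ (C * cubicDecay (ξ - z)) * (M * (1 + ‖z‖⁻¹)) := by
          gcongr
          linarith
      _ = _ := by ring

lemma hasGradientAt_heatConv_one (hm : Measurable h) (hM : 0 ≤ M)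
    (hh : ∀ z, |h z| ≤ M * ‖z‖⁻¹) (ξ : E2) :
    HasGradientAt (heatConv 1 h) (gradConv h ξ) ξ := by
  obtain ⟨C, hC0, hC⟩ := exists_norm_smul_gradHeatKer_le M hM
  let D : E2 → E2 → E2 →L[ℝ] ℝ := fun η z =>
    InnerProductSpace.toDual ℝ E2 (h z • gradHeatKer (η - z))
  have hDn : ∀ η z, ‖D η z‖ = ‖h z • gradHeatKer (η - z)‖ := fun η z =>
    (InnerProductSpace.toDual ℝ E2).norm_map _
  have hDm : ∀ η, AEStronglyMeasurable (D η) := fun η =>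
    (InnerProductSpace.toDual ℝ E2).continuous.comp_aestronglyMeasurable
      (aestronglyMeasurable_smul_gradHeatKer hm η)
  have hDi : Integrable (D ξ) := by
    refine (integrable_smul_gradHeatKer hm hM hh ξ).norm.mono' (hDm ξ) ?_
    exact Eventually.of_forall fun z => (hDn ξ z).le
  have key : HasFDerivAt (fun η => ∫ z, heatKer 1 (η - z) * h z) (∫ z, D ξ z) ξ := by
    refine hasFDerivAt_integral_of_dominated_of_fderiv_le (F' := D) (s := ball ξ 1)
      (bound := fun z => C * (8 * singularWeight ξ z)) (ball_mem_nhds ξ one_pos)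
      (Eventually.of_forall fun η => (integrable_heatKer_mul hm hh hM η).aestronglyMeasurable)
      (integrable_heatKer_mul hm hh hM ξ) (hDm ξ) (Eventually.of_forall fun z η hη => ?_)
      (((integrable_singularWeight ξ).const_mul 8).const_mul C)
      (Eventually.of_forall fun z η _ => ?_)
    · rw [hDn]
      refine (hC h hh η z).trans ?_
      gcongr
      exact singularWeight_le_of_norm_sub_le (mem_ball_iff_norm.1 hη).le z
    · have h1 := (hasGradientAt_iff_hasFDerivAt.1 (hasGradientAt_heatKer_one (η - z)))
      have h2 := (h1.comp η ((hasFDerivAt_id η).sub_const z)).mul_const (h z)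
      refine h2.congr_fderiv ?_
      ext v
      simp [D]
  rw [hasGradientAt_iff_hasFDerivAt]
  refine key.congr_fderiv ?_
  ext v
  rw [ContinuousLinearMap.integral_apply hDi, InnerProductSpace.toDual_apply_apply, gradConv,
    real_inner_comm, ← integral_inner (integrable_smul_gradHeatKer hm hM hh ξ)]
  refine integral_congr_ae (Eventually.of_forall fun z => ?_)
  simp [D, real_inner_comm, inner_smul_right]

end Potential

lemma integrable_gradHeatKer : Integrable gradHeatKer := by
  obtain ⟨C, hC0, hC⟩ := exists_norm_pow_mul_heatKer_le
  refine (integrable_cubicDecay.const_mul C).mono'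
    continuous_gradHeatKer.aestronglyMeasurable (Eventually.of_forall fun w => ?_)
  have h1 := hC w 1 (by norm_num)
  have h2 : 0 ≤ ‖w‖ * heatKer 1 w := mul_nonneg (norm_nonneg _) (heatKer_one_pos _).le
  rw [norm_gradHeatKer]
  rw [pow_one] at h1
  linarith

lemma integral_gradHeatKer : ∫ w, gradHeatKer w = 0 := by
  have h := integral_neg_eq_self gradHeatKer volume
  simp only [gradHeatKer_neg, integral_neg] at h
  have h2 := neg_eq_iff_add_eq_zero.1 h
  rw [← two_smul ℝ] at h2
  exact (smul_eq_zero.1 h2).resolve_left two_ne_zero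

/-- The gradient of the regularization of a function with a `|z|⁻¹` singularity and
`|z|⁻²` local Lipschitz constants decays quadratically, uniformly in the function. -/
lemma exists_norm_gradConv_le (M K : ℝ) (hM : 0 ≤ M) (hK : 0 ≤ K) :
    ∃ C : ℝ, 0 ≤ C ∧ ∀ h : E2 → ℝ, Measurable h → (∀ z, |h z| ≤ M * ‖z‖⁻¹) →
      (∀ a b, a ≠ 0 → b ≠ 0 → |h a - h b| ≤ K * ‖a - b‖ * (‖a‖⁻¹ * ‖b‖⁻¹)) →
      ∀ ξ, ‖gradConv h ξ‖ ≤ C * ((1 + ‖ξ‖) ^ 2)⁻¹ := by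
  obtain ⟨C₁, hC₁0, hC₁⟩ := exists_norm_smul_gradHeatKer_le M hM
  obtain ⟨C₂, hC₂0, hC₂⟩ := exists_norm_pow_mul_heatKer_le
  obtain ⟨I, hI0, hI⟩ := exists_integral_singularWeight_le
  refine ⟨2 * (C₁ * I + K * C₂ * I), by positivity, fun h hm hh hL ξ => ?_⟩
  have b1 : ‖gradConv h ξ‖ ≤ C₁ * I := by
    refine (norm_integral_le_of_norm_le ((integrable_singularWeight ξ).const_mul C₁)
      (Eventually.of_forall (hC₁ h hh ξ))).trans ?_
    rw [integral_const_mul]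
    exact mul_le_mul_of_nonneg_left (hI ξ) hC₁0
  have b2 : ‖ξ‖ ^ 2 * ‖gradConv h ξ‖ ≤ K * C₂ * I := by
    rcases eq_or_ne ξ 0 with rfl | hξ
    · simp only [norm_zero]; ring_nf; positivity
    have hξ' : 0 < ‖ξ‖ := norm_pos_iff.2 hξ
    have e1 : gradConv h ξ = ∫ z, (h z - h ξ) • gradHeatKer (ξ - z) := by
      have hi : Integrable fun z => h ξ • gradHeatKer (ξ - z) :=
        (integrable_gradHeatKer.comp_sub_left ξ).smul (h ξ)
      simp only [sub_smul]
      rw [integral_sub (integrable_smul_gradHeatKer hm hM hh ξ) hi, integral_smul,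
        integral_sub_left_eq_self gradHeatKer, integral_gradHeatKer, smul_zero, sub_zero, gradConv]
    have e2 : ‖ξ‖ ^ 2 * ‖gradConv h ξ‖ =
        ‖∫ z, (‖ξ‖ ^ 2) • ((h z - h ξ) • gradHeatKer (ξ - z))‖ := by
      rw [integral_smul, ← e1, norm_smul, Real.norm_of_nonneg (by positivity)]
    rw [e2]
    refine (norm_integral_le_of_norm_le
      ((integrable_singularWeight ξ).const_mul (K * C₂)) ?_).trans ?_
    · have hz : ∀ᵐ z : E2, z ≠ 0 := by simp [ae_iff]
      filter_upwards [hz] with z hz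
      have g2 := hC₂ (ξ - z) 2 (by norm_num)
      have g3 := hC₂ (ξ - z) 3 (by norm_num)
      have hd := cubicDecay_nonneg (ξ - z)
      have hk := heatKer_one_pos (ξ - z)
      have hL' := hL z ξ hz hξ
      rw [norm_sub_rev] at hL'
      rw [norm_smul, norm_smul, norm_gradHeatKer, Real.norm_of_nonneg (by positivity),
        Real.norm_eq_abs, singularWeight]
      calc ‖ξ‖ ^ 2 * (|h z - h ξ| * (‖ξ - z‖ * heatKer 1 (ξ - z) / 2))
          ≤ ‖ξ‖ ^ 2 * ((K * ‖ξ - z‖ * (‖z‖⁻¹ * ‖ξ‖⁻¹)) *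
              (‖ξ - z‖ * heatKer 1 (ξ - z) / 2)) := by gcongr
        _ = (K / 2) * ((‖ξ‖ * ‖z‖⁻¹) * (‖ξ - z‖ ^ 2 * heatKer 1 (ξ - z))) := by
            field_simp
        _ ≤ (K / 2) * ((‖ξ - z‖ * ‖z‖⁻¹ + 1) * (‖ξ - z‖ ^ 2 * heatKer 1 (ξ - z))) := by
            gcongr
            exact norm_div_norm_le ξ z
        _ = (K / 2) * (‖ξ - z‖ ^ 3 * heatKer 1 (ξ - z) * ‖z‖⁻¹ +
              ‖ξ - z‖ ^ 2 * heatKer 1 (ξ - z)) := by ring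
        _ ≤ (K / 2) * (C₂ * cubicDecay (ξ - z) * ‖z‖⁻¹ + C₂ * cubicDecay (ξ - z)) := by gcongr
        _ = (K / 2) * (C₂ * (cubicDecay (ξ - z) * (1 + ‖z‖⁻¹))) := by ring
        _ ≤ K * (C₂ * (cubicDecay (ξ - z) * (1 + ‖z‖⁻¹))) := by
            gcongr
            linarith
        _ = _ := by ring
    · rw [integral_const_mul]
      exact mul_le_mul_of_nonneg_left (hI ξ) (by positivity)
  rw [← div_eq_mul_inv, le_div_iff₀ (by positivity)]
  have : (1 + ‖ξ‖) ^ 2 ≤ 2 * (1 + ‖ξ‖ ^ 2) := by nlinarith [sq_nonneg (‖ξ‖ - 1)]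
  calc ‖gradConv h ξ‖ * (1 + ‖ξ‖) ^ 2 ≤ ‖gradConv h ξ‖ * (2 * (1 + ‖ξ‖ ^ 2)) := by gcongr
    _ ≤ _ := by linarith

lemma exists_norm_mul_heatConv_inv_norm_le :
    ∃ C : ℝ, ∀ ξ : E2, ‖ξ‖ * heatConv 1 (fun z => ‖z‖⁻¹) ξ ≤ C := by
  obtain ⟨C, hC0, hC⟩ := exists_norm_pow_mul_heatKer_le
  obtain ⟨I, hI0, hI⟩ := exists_integral_singularWeight_le
  refine ⟨C * I, fun ξ => ?_⟩
  have hint : Integrable (fun z : E2 => heatKer 1 (ξ - z) * ‖z‖⁻¹) :=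
    integrable_heatKer_mul (M := 1) (by fun_prop) (fun z => by simp) zero_le_one ξ
  refine le_trans ?_ (mul_le_mul_of_nonneg_left (hI ξ) hC0)
  rw [heatConv, ← integral_const_mul, ← integral_const_mul]
  refine integral_mono (hint.const_mul _) ((integrable_singularWeight ξ).const_mul C) fun z => ?_
  have g0 := hC (ξ - z) 0 (by norm_num)
  have g1 := hC (ξ - z) 1 (by norm_num)
  have hk := heatKer_one_pos (ξ - z)
  simp only [singularWeight]
  calc ‖ξ‖ * (heatKer 1 (ξ - z) * ‖z‖⁻¹) = (‖ξ‖ * ‖z‖⁻¹) * heatKer 1 (ξ - z) := by ring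
    _ ≤ (‖ξ - z‖ * ‖z‖⁻¹ + 1) * heatKer 1 (ξ - z) := by
        gcongr
        exact norm_div_norm_le ξ z
    _ = ‖ξ - z‖ ^ 1 * heatKer 1 (ξ - z) * ‖z‖⁻¹ + ‖ξ - z‖ ^ 0 * heatKer 1 (ξ - z) := by ring
    _ ≤ C * cubicDecay (ξ - z) * ‖z‖⁻¹ + C * cubicDecay (ξ - z) := by gcongr
    _ = _ := by ring

lemma heatConv_inv_norm_zero_pos : 0 < heatConv 1 (fun z : E2 => ‖z‖⁻¹) 0 := by
  have hint : Integrable (fun z : E2 => heatKer 1 (0 - z) * ‖z‖⁻¹) :=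
    integrable_heatKer_mul (M := 1) (by fun_prop) (fun z => by simp) zero_le_one 0
  rw [heatConv, integral_pos_iff_support_of_nonneg
    (fun z => mul_nonneg (heatKer_one_pos _).le (by positivity)) hint]
  have : Function.support (fun z : E2 => heatKer 1 (0 - z) * ‖z‖⁻¹) = {0}ᶜ := by
    ext z
    simp [(heatKer_one_pos _).ne']
  rw [this]
  exact isOpen_compl_singleton.measure_pos volume
    (exists_ne (0 : E2))

lemma exists_gradConv_inv_norm_ne_zero : ∃ ξ : E2, gradConv (fun z => ‖z‖⁻¹) ξ ≠ 0 := by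
  by_contra! hzero
  have hg : ∀ ξ : E2, HasFDerivAt (heatConv 1 fun z : E2 => ‖z‖⁻¹) (0 : E2 →L[ℝ] ℝ) ξ := by
    intro ξ
    have := hasGradientAt_heatConv_one (h := fun z : E2 => ‖z‖⁻¹) (M := 1) (by fun_prop)
      zero_le_one (fun z => by simp) ξ
    rw [hzero, hasGradientAt_iff_hasFDerivAt, map_zero] at this
    exact this
  have hconst := is_const_of_fderiv_eq_zero (fun ξ => (hg ξ).differentiableAt)
    (fun ξ => (hg ξ).fderiv)
  obtain ⟨C, hC⟩ := exists_norm_mul_heatConv_inv_norm_le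
  have hpos := heatConv_inv_norm_zero_pos
  obtain ⟨ξ, hξ⟩ := NormedSpace.exists_lt_norm ℝ E2
    (C / heatConv 1 (fun z : E2 => ‖z‖⁻¹) 0)
  have h1 := hC ξ
  rw [hconst ξ 0] at h1
  rw [div_lt_iff₀ hpos] at hξ
  linarith

/-- The rescaled vorticity profile `φ(s z)/|z|`. -/
noncomputable def scaledProfile (φ : E2 → ℝ) (s : ℝ) (z : E2) : ℝ := φ (s • z) / ‖z‖

section Profile

variable {φ : E2 → ℝ} {M : ℝ}

lemma measurable_scaledProfile (hφ : Continuous φ) (s : ℝ) : Measurable (scaledProfile φ s) := by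
  unfold scaledProfile
  have := hφ.measurable
  fun_prop

lemma abs_scaledProfile_le (hM : ∀ x, |φ x| ≤ M) (s : ℝ) (z : E2) :
    |scaledProfile φ s z| ≤ M * ‖z‖⁻¹ := by
  rw [scaledProfile, abs_div, abs_norm, div_eq_mul_inv]
  gcongr
  exact hM _

lemma abs_inv_norm_sub_inv_norm_le {a b : E2} (ha : a ≠ 0) (hb : b ≠ 0) :
    |‖a‖⁻¹ - ‖b‖⁻¹| ≤ ‖a - b‖ * (‖a‖⁻¹ * ‖b‖⁻¹) := by
  have ha' : ‖a‖ ≠ 0 := norm_ne_zero_iff.2 ha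
  have hb' : ‖b‖ ≠ 0 := norm_ne_zero_iff.2 hb
  have : ‖a‖⁻¹ - ‖b‖⁻¹ = (‖b‖ - ‖a‖) * (‖a‖⁻¹ * ‖b‖⁻¹) := by
    field_simp
  rw [this, abs_mul, abs_of_nonneg (by positivity : 0 ≤ ‖a‖⁻¹ * ‖b‖⁻¹), norm_sub_rev]
  gcongr
  exact abs_norm_sub_norm_le b a

lemma abs_scaledProfile_sub_le {L : ℝ} (hM : ∀ x, |φ x| ≤ M) (hL0 : 0 ≤ L)
    (hL : ∀ x y, |φ x - φ y| ≤ L * ‖x - y‖) (hsupp : ∀ x, 1 < ‖x‖ → φ x = 0)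
    {s : ℝ} (hs : 0 ≤ s) {a b : E2} (ha : a ≠ 0) (hb : b ≠ 0) :
    |scaledProfile φ s a - scaledProfile φ s b| ≤
      (M + L) * ‖a - b‖ * (‖a‖⁻¹ * ‖b‖⁻¹) := by
  have hM0 : 0 ≤ M := (abs_nonneg _).trans (hM 0)
  have near : ∀ a b : E2, a ≠ 0 → b ≠ 0 → s * ‖a‖ ≤ 1 →
      |scaledProfile φ s a - scaledProfile φ s b| ≤
        (M + L) * ‖a - b‖ * (‖a‖⁻¹ * ‖b‖⁻¹) := by
    intro a b ha hb h1
    have hs' : s ≤ ‖a‖⁻¹ := by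
      rwa [← one_div, le_div_iff₀ (norm_pos_iff.2 ha)]
    have e : scaledProfile φ s a - scaledProfile φ s b =
        φ (s • a) * (‖a‖⁻¹ - ‖b‖⁻¹) + (φ (s • a) - φ (s • b)) * ‖b‖⁻¹ := by
      simp only [scaledProfile]; ring
    have hl := hL (s • a) (s • b)
    rw [← smul_sub, norm_smul, Real.norm_of_nonneg hs] at hl
    rw [e]
    calc _ ≤ |φ (s • a)| * |‖a‖⁻¹ - ‖b‖⁻¹| + |φ (s • a) - φ (s • b)| * ‖b‖⁻¹ := by
          refine (abs_add_le _ _).trans_eq ?_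
          rw [abs_mul, abs_mul, abs_of_nonneg (by positivity : 0 ≤ ‖b‖⁻¹)]
      _ ≤ M * (‖a - b‖ * (‖a‖⁻¹ * ‖b‖⁻¹)) + (L * (‖a‖⁻¹ * ‖a - b‖)) * ‖b‖⁻¹ := by
          gcongr
          · exact hM _
          · exact abs_inv_norm_sub_inv_norm_le ha hb
          · exact hl.trans (by gcongr)
      _ = _ := by ring
  rcases le_or_gt (s * ‖a‖) 1 with h1 | h1
  · exact near a b ha hb h1
  rcases le_or_gt (s * ‖b‖) 1 with h2 | h2
  · rw [abs_sub_comm, norm_sub_rev, mul_comm ‖a‖⁻¹]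
    exact near b a hb ha h2
  · have hz : ∀ c : E2, 1 < s * ‖c‖ → scaledProfile φ s c = 0 := fun c hc => by
      rw [scaledProfile, hsupp _ (by rwa [norm_smul, Real.norm_of_nonneg hs]), zero_div]
    rw [hz a h1, hz b h2, sub_zero, abs_zero]
    positivity

lemma heatKer_sq_smul {s : ℝ} (hs : s ≠ 0) (w : E2) :
    heatKer (s ^ 2) (s • w) = (s ^ 2)⁻¹ * heatKer 1 w := by
  have : -‖s • w‖ ^ 2 / (4 * s ^ 2) = -‖w‖ ^ 2 / (4 * 1) := by
    rw [norm_smul, mul_pow, Real.norm_eq_abs, sq_abs]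
    field_simp
  rw [heatKer, heatKer, this, mul_inv]
  ring

lemma heatConv_sq_omega0 {s : ℝ} (hs : 0 < s) (x : E2) :
    heatConv (s ^ 2) (omega0 φ) x = s⁻¹ * heatConv 1 (scaledProfile φ s) (s⁻¹ • x) := by
  have h := Measure.integral_comp_smul volume
    (fun y => heatKer (s ^ 2) (x - y) * omega0 φ y) s
  rw [finrank_euclideanSpace_fin, abs_of_nonneg (by positivity), smul_eq_mul] at h
  have h2 : ∀ z : E2, heatKer (s ^ 2) (x - s • z) * omega0 φ (s • z) =
      ((s ^ 2)⁻¹ * s⁻¹) * (heatKer 1 (s⁻¹ • x - z) * scaledProfile φ s z) := by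
    intro z
    have : x - s • z = s • (s⁻¹ • x - z) := by
      rw [smul_sub, smul_inv_smul₀ hs.ne']
    rw [this, heatKer_sq_smul hs.ne', omega0, scaledProfile, norm_smul,
      Real.norm_of_nonneg hs.le, div_mul_eq_div_div_swap]
    ring
  simp only [h2] at h
  rw [integral_const_mul, mul_assoc] at h
  exact (mul_left_cancel₀ (by positivity) h).symm

lemma gradient_heatConv_sq_omega0 (hφ : Continuous φ) (hM : ∀ x, |φ x| ≤ M) {s : ℝ}
    (hs : 0 < s) (ξ : E2) :
    gradient (heatConv (s ^ 2) (omega0 φ)) (s • ξ) =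
      (s ^ 2)⁻¹ • gradConv (scaledProfile φ s) ξ := by
  refine HasGradientAt.gradient ?_
  have hM0 : 0 ≤ M := (abs_nonneg _).trans (hM 0)
  have h1 := hasGradientAt_heatConv_one (measurable_scaledProfile hφ s) hM0
    (abs_scaledProfile_le hM s) ξ
  rw [hasGradientAt_iff_hasFDerivAt] at h1 ⊢
  have e : heatConv (s ^ 2) (omega0 φ) =
      fun x => s⁻¹ * heatConv 1 (scaledProfile φ s) (s⁻¹ • x) :=
    funext (heatConv_sq_omega0 hs)
  have h2 : HasFDerivAt (fun x : E2 => s⁻¹ • x) (s⁻¹ • ContinuousLinearMap.id ℝ E2) (s • ξ) :=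
    (hasFDerivAt_id (s • ξ)).const_smul s⁻¹
  rw [← inv_smul_smul₀ hs.ne' ξ] at h1
  rw [e]
  refine ((h1.comp (s • ξ) h2).const_mul s⁻¹).congr_fderiv ?_
  ext v
  simp [inv_smul_smul₀ hs.ne']
  ring

lemma integral_defect_eq (hφ : Continuous φ) (hM : ∀ x, |φ x| ≤ M) {ν t : ℝ} (hν : 0 < ν)
    (ht : 0 < t) (f : E2 → ℝ) :
    ∫ x : E2, ν * ‖gradient (heatConv (ν * t) (omega0 φ)) x‖ ^ 2 * f x =
      t⁻¹ * ∫ ξ, ‖gradConv (scaledProfile φ √(ν * t)) ξ‖ ^ 2 * f (√(ν * t) • ξ) := by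
  have hs : 0 < √(ν * t) := Real.sqrt_pos.2 (by positivity)
  have hsq : √(ν * t) ^ 2 = ν * t := Real.sq_sqrt (by positivity)
  have h := Measure.integral_comp_smul volume
    (fun x => ν * ‖gradient (heatConv (ν * t) (omega0 φ)) x‖ ^ 2 * f x) √(ν * t)
  have h2 : ∀ ξ : E2, ‖gradient (heatConv (ν * t) (omega0 φ)) (√(ν * t) • ξ)‖ =
      (ν * t)⁻¹ * ‖gradConv (scaledProfile φ √(ν * t)) ξ‖ := by
    intro ξ
    have := gradient_heatConv_sq_omega0 hφ hM hs ξ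
    rw [hsq] at this
    rw [this, norm_smul, Real.norm_of_nonneg (by positivity)]
  simp only [h2] at h
  rw [finrank_euclideanSpace_fin, hsq, abs_of_nonneg (by positivity), smul_eq_mul,
    inv_mul_eq_div, eq_div_iff (by positivity)] at h
  rw [← h, mul_comm, ← integral_const_mul, ← integral_const_mul]
  refine integral_congr_ae (Eventually.of_forall fun ξ => ?_)
  simp only
  field_simp

lemma tendsto_gradConv_scaledProfile (hφ : Continuous φ) (hM : ∀ x, |φ x| ≤ M) (ξ : E2) :
    Tendsto (fun s => gradConv (scaledProfile φ s) ξ) (𝓝[>] 0)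
      (𝓝 (gradConv (scaledProfile φ 0) ξ)) := by
  have hM0 : 0 ≤ M := (abs_nonneg _).trans (hM 0)
  obtain ⟨C, -, hC⟩ := exists_norm_smul_gradHeatKer_le M hM0
  refine Tendsto.mono_left ?_ nhdsWithin_le_nhds
  refine tendsto_integral_filter_of_dominated_convergence (fun z => C * singularWeight ξ z)
    (Eventually.of_forall fun s =>
      aestronglyMeasurable_smul_gradHeatKer (measurable_scaledProfile hφ s) ξ)
    (Eventually.of_forall fun s => Eventually.of_forall
      (hC _ (abs_scaledProfile_le hM s) ξ))
    ((integrable_singularWeight ξ).const_mul C) (Eventually.of_forall fun z => ?_)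
  have : Continuous fun s : ℝ => scaledProfile φ s z • gradHeatKer (ξ - z) := by
    unfold scaledProfile; fun_prop
  exact this.tendsto 0

end Profile

/-- there is a constant `c > 0`, independent of `t` and `f`, such that for
all `t > 0` and all test functions `f`,
`∫ ν |∇(G_{νt} ∗ ω₀)|² f dx → (c/t) f(0)` as `ν → 0⁺`; i.e. the viscous enstrophy
defect `Z^V(ω₀)` exists and equals `(c/t) δ₀`. -/
theorem viscous_defect_is_dirac
    (φ : E2 → ℝ) (hφsm : ContDiff ℝ (⊤ : ℕ∞) φ) (hφcpt : HasCompactSupport φ)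
    (hφsupp : tsupport φ ⊆ ball (0 : E2) 1)
    (hφrad : ∃ g : ℝ → ℝ, ∀ x, φ x = g ‖x‖)
    (hφone : ∀ x : E2, ‖x‖ < 1/2 → φ x = 1) :
    ∃ c : ℝ, 0 < c ∧ ∀ t : ℝ, 0 < t →
      ∀ f : E2 → ℝ, ContDiff ℝ (⊤ : ℕ∞) f → HasCompactSupport f →
        Tendsto (fun ν : ℝ =>
            ∫ x : E2, ν * ‖gradient (heatConv (ν * t) (omega0 φ)) x‖ ^ 2 * f x)
          (𝓝[>] 0) (𝓝 (c / t * f 0)) := by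
  have hφc : Continuous φ := hφsm.continuous
  obtain ⟨M, hM⟩ := hφcpt.exists_bound_of_continuous hφc
  simp only [Real.norm_eq_abs] at hM
  have hM0 : 0 ≤ M := (abs_nonneg _).trans (hM 0)
  obtain ⟨L, hL⟩ := hφsm.lipschitzWith_of_hasCompactSupport hφcpt (by simp)
  have hsupp : ∀ x, 1 < ‖x‖ → φ x = 0 := fun x hx =>
    image_eq_zero_of_notMem_tsupport fun hmem =>
      (mem_ball_zero_iff.1 (hφsupp hmem)).not_gt hx
  obtain ⟨C, hC0, hC⟩ := exists_norm_gradConv_le M (M + L) hM0 (by positivity)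
  have hdecay : ∀ s : ℝ, 0 ≤ s → ∀ ξ,
      ‖gradConv (scaledProfile φ s) ξ‖ ^ 2 ≤ C ^ 2 * ((1 + ‖ξ‖) ^ 4)⁻¹ := by
    intro s hs ξ
    have h := hC _ (measurable_scaledProfile hφc s) (abs_scaledProfile_le hM s)
      (fun a b ha hb => abs_scaledProfile_sub_le hM L.coe_nonneg
        (fun x y => by simpa [Real.dist_eq, dist_eq_norm] using hL.dist_le_mul x y)
        hsupp hs ha hb) ξ
    calc _ ≤ (C * ((1 + ‖ξ‖) ^ 2)⁻¹) ^ 2 := by gcongr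
      _ = _ := by rw [mul_pow, inv_pow, ← pow_mul]
  have hcont : ∀ s, Continuous (gradConv (scaledProfile φ s)) := fun s =>
    continuous_gradConv (measurable_scaledProfile hφc s) hM0 (abs_scaledProfile_le hM s)
  have hbound : Integrable fun ξ : E2 => C ^ 2 * ((1 + ‖ξ‖) ^ 4)⁻¹ :=
    (integrable_inv_one_add_norm_pow (by norm_num)).const_mul _
  have hprofile : scaledProfile φ 0 = fun z => ‖z‖⁻¹ := by
    ext z
    simp [scaledProfile, hφone 0 (by simp)]
  refine ⟨∫ ξ, ‖gradConv (scaledProfile φ 0) ξ‖ ^ 2, ?_, fun t ht f hf hfc => ?_⟩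
  · obtain ⟨ξ, hξ⟩ := exists_gradConv_inv_norm_ne_zero
    rw [← hprofile] at hξ
    refine integral_pos_of_integrable_nonneg_nonzero (x := ξ) (by have := hcont 0; fun_prop)
      (hbound.mono' (by have := hcont 0; exact Continuous.aestronglyMeasurable (by fun_prop))
        (Eventually.of_forall fun ξ => ?_)) (fun ξ => by positivity)
      (by simpa using hξ)
    rw [Real.norm_of_nonneg (by positivity)]
    exact hdecay 0 le_rfl ξ
  · obtain ⟨F, hF⟩ := hfc.exists_bound_of_continuous hf.continuous
    have hfcont := hf.continuous
    have hlim : Tendsto (fun s : ℝ => ∫ ξ, ‖gradConv (scaledProfile φ s) ξ‖ ^ 2 * f (s • ξ))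
        (𝓝[>] 0) (𝓝 (∫ ξ, ‖gradConv (scaledProfile φ 0) ξ‖ ^ 2 * f 0)) := by
      refine tendsto_integral_filter_of_dominated_convergence
        (fun ξ => C ^ 2 * ((1 + ‖ξ‖) ^ 4)⁻¹ * F) ?_ ?_ (hbound.mul_const F)
        (Eventually.of_forall fun ξ => ?_)
      · refine Eventually.of_forall fun s => ?_
        have := hcont s
        exact Continuous.aestronglyMeasurable (by fun_prop)
      · filter_upwards [self_mem_nhdsWithin] with s hs
        refine Eventually.of_forall fun ξ => ?_
        rw [norm_mul, Real.norm_of_nonneg (by positivity)]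
        gcongr
        · exact hdecay s (le_of_lt hs) ξ
        · exact hF _
      · refine ((tendsto_gradConv_scaledProfile hφc hM ξ).norm.pow 2).mul ?_
        have : Continuous fun s : ℝ => f (s • ξ) := by fun_prop
        simpa using (this.tendsto 0).mono_left nhdsWithin_le_nhds
    have hsqrt : Tendsto (fun ν : ℝ => √(ν * t)) (𝓝[>] 0) (𝓝[>] 0) := by
      refine tendsto_nhdsWithin_iff.2 ⟨?_, ?_⟩
      · have : Continuous fun ν : ℝ => √(ν * t) := by fun_prop
        simpa using (this.tendsto 0).mono_left nhdsWithin_le_nhds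
      · filter_upwards [self_mem_nhdsWithin] with ν hν
        exact Real.sqrt_pos.2 (mul_pos hν ht)
    have hmain := (hlim.comp hsqrt).const_mul t⁻¹
    rw [integral_mul_const, ← mul_assoc, inv_mul_eq_div] at hmain
    refine hmain.congr' ?_
    filter_upwards [self_mem_nhdsWithin] with ν hν
    exact (integral_defect_eq hφc hM hν ht f).symm
end
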